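/- arXiv:1005.3836 — 4 statements merged into one kernel-verified Lean document; each statement's English description precedes it below -/
import Mathlib

section
/- For every triangle T in the Euclidean plane (the convex hull of three affinely independent points of ℝ²), there exists a locally finite monohedral tiling of ℝ² with prototile T; that is, ℝ² can be tiled by isometric copies of T. -/
open Set

noncomputable section

abbrev Euc (d : ℕ) := EuclideanSpace ℝ (Fin d)

/-- A tiling of `ℝ^d`: a family of closed sets covering the space with pairwise
disjoint interiors. -/
def IsTiling {d : ℕ} (𝒯 : Set (Set (Euc d))) : Prop :=
  (∀ T ∈ 𝒯, IsClosed T) ∧ ⋃₀ 𝒯 = Set.univ ∧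
    𝒯.Pairwise fun S T => interior S ∩ interior T = ∅

/-- Local finiteness: every compact set meets only finitely many tiles. -/
def LocallyFiniteTiling {d : ℕ} (𝒯 : Set (Set (Euc d))) : Prop :=
  ∀ K : Set (Euc d), IsCompact K → {T ∈ 𝒯 | (T ∩ K).Nonempty}.Finite

/-- `S` is an isometric copy of `T`. -/
def IsometricCopy {d : ℕ} (S T : Set (Euc d)) : Prop :=
  ∃ g : Euc d ≃ᵢ Euc d, g '' T = S

/-- A monohedral tiling with prototile `T`. -/
def Monohedral {d : ℕ} (𝒯 : Set (Set (Euc d))) (T : Set (Euc d)) : Prop :=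
  ∀ S ∈ 𝒯, IsometricCopy S T

/-- A convex `d`-polytope in `ℝ^d`: convex hull of a finite set, with nonempty interior. -/
def IsConvexPolytope {d : ℕ} (P : Set (Euc d)) : Prop :=
  (∃ V : Finset (Euc d), P = convexHull ℝ (V : Set (Euc d))) ∧ (interior P).Nonempty

/-- A tiling is face-to-face if the intersection of any two distinct tiles is a
face (extreme subset), possibly empty, of each of them. -/
def FaceToFace {d : ℕ} (𝒯 : Set (Set (Euc d))) : Prop :=
  ∀ S ∈ 𝒯, ∀ T ∈ 𝒯, S ≠ T → IsExtreme ℝ S (S ∩ T) ∧ IsExtreme ℝ T (S ∩ T)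

/-- Combinatorial equivalence: an order isomorphism between the face posets
(posets of extreme subsets ordered by inclusion). -/
def CombEquiv {d e : ℕ} (P : Set (Euc d)) (Q : Set (Euc e)) : Prop :=
  Nonempty ({F : Set (Euc d) // IsExtreme ℝ P F} ≃o {F : Set (Euc e) // IsExtreme ℝ Q F})

/-- A facet: a maximal proper nonempty face. -/
def IsFacet {d : ℕ} (Q F : Set (Euc d)) : Prop :=
  IsExtreme ℝ Q F ∧ F.Nonempty ∧ F ≠ Q ∧
    ∀ G : Set (Euc d), IsExtreme ℝ Q G → G ≠ Q → F ⊆ G → G = F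

/-- The triangle with corner `(m, n)` in the lattice coordinates `x`, `y`, pointing up. -/
def upTile {E : Type*} (x y : E → ℝ) (k : ℤ × ℤ) : Set E :=
  {p | (k.1 : ℝ) ≤ x p ∧ (k.2 : ℝ) ≤ y p ∧ x p + y p ≤ k.1 + k.2 + 1}

/-- The triangle completing `upTile x y k` to a parallelogram. -/
def downTile {E : Type*} (x y : E → ℝ) (k : ℤ × ℤ) : Set E :=
  {p | x p ≤ k.1 + 1 ∧ y p ≤ k.2 + 1 ∧ (k.1 : ℝ) + k.2 + 1 ≤ x p + y p}

/-- The family of all up and down lattice triangles. -/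
def latticeTriangles {E : Type*} (x y : E → ℝ) : Set (Set E) :=
  range (upTile x y) ∪ range (downTile x y)

section Topology

variable {E : Type*} [TopologicalSpace E] {x y : E → ℝ}

theorem isClosed_of_mem_latticeTriangles (hx : Continuous x) (hy : Continuous y) {S : Set E}
    (hS : S ∈ latticeTriangles x y) : IsClosed S := by
  rcases hS with ⟨k, rfl⟩ | ⟨k, rfl⟩
  · exact (isClosed_le continuous_const hx).inter ((isClosed_le continuous_const hy).inter
      (isClosed_le (hx.add hy) continuous_const))
  · exact (isClosed_le hx continuous_const).inter ((isClosed_le hy continuous_const).inter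
      (isClosed_le continuous_const (hx.add hy)))

theorem lt_of_mem_interior_of_le {f : E → ℝ} (hf : IsOpenMap f) {S : Set E} {r : ℝ} {p : E}
    (hS : ∀ q ∈ S, r ≤ f q) (hp : p ∈ interior S) : r < f p := by
  have h := interior_mono (t := Ici r) (image_subset_iff.2 hS)
    (hf.image_interior_subset S (mem_image_of_mem f hp))
  rwa [interior_Ici] at h

theorem lt_of_mem_interior_of_ge {f : E → ℝ} (hf : IsOpenMap f) {S : Set E} {r : ℝ} {p : E}
    (hS : ∀ q ∈ S, f q ≤ r) (hp : p ∈ interior S) : f p < r := by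
  have h := interior_mono (t := Iic r) (image_subset_iff.2 hS)
    (hf.image_interior_subset S (mem_image_of_mem f hp))
  rwa [interior_Iic] at h

theorem pairwise_interior_latticeTriangles (hx : IsOpenMap x) (hy : IsOpenMap y)
    (hxy : IsOpenMap fun p => x p + y p) :
    (latticeTriangles x y).Pairwise fun S T => interior S ∩ interior T = ∅ := by
  have up : ∀ k, ∀ p ∈ interior (upTile x y k),
      k = (⌊x p⌋, ⌊y p⌋) ∧ x p + y p < k.1 + k.2 + 1 := by
    intro k p hp
    have h1 := lt_of_mem_interior_of_le hx (fun q hq => hq.1) hp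
    have h2 := lt_of_mem_interior_of_le hy (fun q hq => hq.2.1) hp
    have h3 := lt_of_mem_interior_of_ge hxy (fun q hq => hq.2.2) hp
    refine ⟨Prod.ext ?_ ?_, h3⟩
    · exact (Int.floor_eq_iff.2 ⟨h1.le, by linarith⟩).symm
    · exact (Int.floor_eq_iff.2 ⟨h2.le, by linarith⟩).symm
  have down : ∀ k, ∀ p ∈ interior (downTile x y k),
      k = (⌊x p⌋, ⌊y p⌋) ∧ (k.1 : ℝ) + k.2 + 1 < x p + y p := by
    intro k p hp
    have h1 := lt_of_mem_interior_of_ge hx (fun q hq => hq.1) hp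
    have h2 := lt_of_mem_interior_of_ge hy (fun q hq => hq.2.1) hp
    have h3 := lt_of_mem_interior_of_le hxy (fun q hq => hq.2.2) hp
    refine ⟨Prod.ext ?_ ?_, h3⟩
    · exact (Int.floor_eq_iff.2 ⟨by linarith, h1⟩).symm
    · exact (Int.floor_eq_iff.2 ⟨by linarith, h2⟩).symm
  intro S hS T hT hne
  by_contra hST
  obtain ⟨p, hpS, hpT⟩ := nonempty_iff_ne_empty.2 hST
  rcases hS with ⟨k, rfl⟩ | ⟨k, rfl⟩ <;> rcases hT with ⟨l, rfl⟩ | ⟨l, rfl⟩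
  · exact hne (by rw [(up k p hpS).1, (up l p hpT).1])
  · obtain ⟨h1, h2⟩ := up k p hpS
    obtain ⟨h3, h4⟩ := down l p hpT
    obtain rfl := h1.trans h3.symm
    exact lt_asymm h2 h4
  · obtain ⟨h1, h2⟩ := down k p hpS
    obtain ⟨h3, h4⟩ := up l p hpT
    obtain rfl := h1.trans h3.symm
    exact lt_asymm h2 h4
  · exact hne (by rw [(down k p hpS).1, (down l p hpT).1])

theorem finite_latticeTriangles_inter_nonempty (hx : Continuous x) (hy : Continuous y)
    {K : Set E} (hK : IsCompact K) :
    {S ∈ latticeTriangles x y | (S ∩ K).Nonempty}.Finite := by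
  obtain ⟨X, hX⟩ := hK.exists_bound_of_continuousOn hx.continuousOn
  obtain ⟨Y, hY⟩ := hK.exists_bound_of_continuousOn hy.continuousOn
  let R : Set (ℤ × ℤ) := Icc ⌊-X - Y - 2⌋ ⌈X + Y + 2⌉ ×ˢ Icc ⌊-X - Y - 2⌋ ⌈X + Y + 2⌉
  have hR : R.Finite := (finite_Icc _ _).prod (finite_Icc _ _)
  have bound : ∀ m : ℤ, -X - Y - 2 ≤ m → (m : ℝ) ≤ X + Y + 2 →
      m ∈ Icc ⌊-X - Y - 2⌋ ⌈X + Y + 2⌉ := fun m h1 h2 =>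
    ⟨by exact_mod_cast (Int.floor_le _).trans h1, by exact_mod_cast h2.trans (Int.le_ceil _)⟩
  refine ((hR.image (upTile x y)).union (hR.image (downTile x y))).subset ?_
  rintro S ⟨⟨k, rfl⟩ | ⟨k, rfl⟩, p, ⟨h1, h2, h3⟩, hpK⟩
  · have hx := abs_le.1 (hX p hpK)
    have hy := abs_le.1 (hY p hpK)
    exact Or.inl (mem_image_of_mem _ ⟨bound _ (by linarith) (by linarith),
      bound _ (by linarith) (by linarith)⟩)
  · have hx := abs_le.1 (hX p hpK)
    have hy := abs_le.1 (hY p hpK)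
    exact Or.inr (mem_image_of_mem _ ⟨bound _ (by linarith) (by linarith),
      bound _ (by linarith) (by linarith)⟩)

end Topology

theorem sUnion_latticeTriangles {E : Type*} (x y : E → ℝ) :
    ⋃₀ latticeTriangles x y = univ := by
  refine eq_univ_of_forall fun p => ?_
  rcases le_total (x p + y p) (⌊x p⌋ + ⌊y p⌋ + 1) with h | h
  · exact ⟨_, Or.inl ⟨(⌊x p⌋, ⌊y p⌋), rfl⟩, Int.floor_le _, Int.floor_le _, h⟩
  · exact ⟨_, Or.inr ⟨(⌊x p⌋, ⌊y p⌋), rfl⟩, (Int.lt_floor_add_one _).le,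
      (Int.lt_floor_add_one _).le, h⟩

/-- A triangle described by inequalities in the affine coordinates at the vertex `a`. -/
theorem convexHull_triple_eq_of_coords {E : Type*} [AddCommGroup E] [Module ℝ E] {a b c : E}
    {f g : E →ₗ[ℝ] ℝ} (hfb : f (b - a) = 1) (hfc : f (c - a) = 0) (hgb : g (b - a) = 0)
    (hgc : g (c - a) = 1) (hfg : ∀ w, f w • (b - a) + g w • (c - a) = w) :
    convexHull ℝ {a, b, c} = {p | 0 ≤ f (p - a) ∧ 0 ≤ g (p - a) ∧ f (p - a) + g (p - a) ≤ 1} := by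
  apply Subset.antisymm
  · refine convexHull_min ?_ ?_
    · rintro p (rfl | rfl | rfl) <;> rw [mem_ofPred_eq]
      · simp
      · norm_num [hfb, hgb, -map_sub]
      · norm_num [hfc, hgc, -map_sub]
    · intro p ⟨p1, p2, p3⟩ q ⟨q1, q2, q3⟩ s t hs ht hst
      have key : s • p + t • q - a = s • (p - a) + t • (q - a) := by
        obtain rfl : t = 1 - s := by linarith
        module
      simp only [mem_ofPred_eq, key, map_add, map_smul, smul_eq_mul]
      refine ⟨by positivity, by positivity, ?_⟩
      nlinarith
  · rintro p ⟨h1, h2, h3⟩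
    have hp : (1 - f (p - a) - g (p - a)) • a + f (p - a) • b + g (p - a) • c = p := by
      have := hfg (p - a)
      rw [← sub_eq_zero] at this ⊢
      rw [← this]
      module
    rw [← hp]
    generalize f (p - a) = s at *
    generalize g (p - a) = t at *
    have := (convex_convexHull ℝ {a, b, c}).sum_mem (t := Finset.univ)
      (w := ![1 - s - t, s, t]) (z := ![a, b, c])
      (by simpa [Fin.forall_fin_succ, h1, h2] using by linarith) (by simp only [Fin.sum_univ_three, Matrix.cons_val]; ring)
      (fun i _ => subset_convexHull ℝ _ (by fin_cases i <;> simp))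
    simpa [Fin.sum_univ_three] using this

/-- every triangle tiles the plane. -/
theorem triangle_is_plane_filler (a b c : Euc 2)
    (h : AffineIndependent ℝ ![a, b, c]) :
    ∃ 𝒯 : Set (Set (Euc 2)), IsTiling 𝒯 ∧ LocallyFiniteTiling 𝒯 ∧
      Monohedral 𝒯 (convexHull ℝ {a, b, c}) := by
  have hli : LinearIndependent ℝ ![b - a, c - a] := by
    rw [affineIndependent_iff_linearIndependent_vsub ℝ _ (0 : Fin 3)] at h
    have := h.comp (fun i : Fin 2 => (⟨i.succ, Fin.succ_ne_zero i⟩ : {i : Fin 3 // i ≠ 0}))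
      fun i j hij => Fin.succ_injective _ (Subtype.ext_iff.1 hij)
    have heq : ![b - a, c - a] = (fun i : {i : Fin 3 // i ≠ 0} =>
        ![a, b, c] i -ᵥ ![a, b, c] 0) ∘ fun i : Fin 2 => ⟨i.succ, Fin.succ_ne_zero i⟩ := by
      ext i : 1
      fin_cases i <;> simp
    rw [heq]
    exact this
  let B := basisOfLinearIndependentOfCardEqFinrank hli (by simp)
  have hB : ⇑B = ![b - a, c - a] := coe_basisOfLinearIndependentOfCardEqFinrank _ _
  have hB0 : B 0 = b - a := by simp [hB]
  have hB1 : B 1 = c - a := by simp [hB]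
  have hfb : B.coord 0 (b - a) = 1 := by simp [← hB0]
  have hfc : B.coord 0 (c - a) = 0 := by simp [← hB1]
  have hgb : B.coord 1 (b - a) = 0 := by simp [← hB0]
  have hgc : B.coord 1 (c - a) = 1 := by simp [← hB1]
  have hfg : ∀ w, B.coord 0 w • (b - a) + B.coord 1 w • (c - a) = w := fun w => by
    have := B.sum_repr w
    rwa [Fin.sum_univ_two, hB0, hB1] at this
  generalize B.coord 0 = f at *
  generalize B.coord 1 = g at *
  have hopen : ∀ (l : Euc 2 →ₗ[ℝ] ℝ) (w : Euc 2), l w = 1 → IsOpenMap fun p => l (p - a) := by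
    intro l w hl
    have h0 : l.toContinuousLinearMap ≠ 0 := fun h0 => by
      have := DFunLike.congr_fun h0 w
      simp [hl] at this
    exact (l.toContinuousLinearMap.isOpenMap_of_ne_zero h0).comp (Homeomorph.subRight a).isOpenMap
  have hcont : ∀ l : Euc 2 →ₗ[ℝ] ℝ, Continuous fun p => l (p - a) := fun l =>
    l.continuous_of_finiteDimensional.comp (continuous_sub_right a)
  refine ⟨latticeTriangles (fun p => f (p - a)) (fun p => g (p - a)),
    ⟨fun S hS => isClosed_of_mem_latticeTriangles (hcont f) (hcont g) hS,
      sUnion_latticeTriangles _ _,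
      pairwise_interior_latticeTriangles (hopen f _ hfb) (hopen g _ hgc)
        (hopen (f + g) (b - a) (by simp [hfb, hgb]))⟩,
    fun K hK => finite_latticeTriangles_inter_nonempty (hcont f) (hcont g) hK, ?_⟩
  rw [convexHull_triple_eq_of_coords hfb hfc hgb hgc hfg]
  rintro S (⟨⟨m, n⟩, rfl⟩ | ⟨⟨m, n⟩, rfl⟩)
  · refine ⟨IsometryEquiv.addRight ((m : ℝ) • (b - a) + (n : ℝ) • (c - a)), ?_⟩
    rw [← IsometryEquiv.preimage_symm]
    ext p
    have key : p - ((m : ℝ) • (b - a) + (n : ℝ) • (c - a)) - a =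
        (p - a) - ((m : ℝ) • (b - a) + (n : ℝ) • (c - a)) := by abel
    simp only [IsometryEquiv.addRight_symm, mem_preimage, IsometryEquiv.addRight_apply,
      mem_ofPred_eq, upTile, ← sub_eq_add_neg, key]
    simp only [map_sub f (p - a), map_sub g (p - a), map_add, map_smul, hfb, hfc, hgb, hgc,
      smul_eq_mul]
    constructor <;> rintro ⟨h1, h2, h3⟩ <;> refine ⟨?_, ?_, ?_⟩ <;> linarith
  · refine ⟨IsometryEquiv.subLeft
      ((m + 1 : ℝ) • (b - a) + (n + 1 : ℝ) • (c - a) + (a + a)), ?_⟩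
    rw [← IsometryEquiv.preimage_symm]
    ext p
    have key : -p + ((m + 1 : ℝ) • (b - a) + (n + 1 : ℝ) • (c - a) + (a + a)) - a =
        ((m + 1 : ℝ) • (b - a) + (n + 1 : ℝ) • (c - a)) - (p - a) := by abel
    simp only [mem_preimage, IsometryEquiv.subLeft_symm_apply, mem_ofPred_eq, downTile, key]
    simp only [fun w => map_sub f w (p - a), fun w => map_sub g w (p - a), map_add, map_smul,
      hfb, hfc, hgb, hgc, smul_eq_mul]
    constructor <;> rintro ⟨h1, h2, h3⟩ <;> refine ⟨?_, ?_, ?_⟩ <;> linarith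
end
end

section
/- For every convex quadrilateral Q in the Euclidean plane (a compact convex set that is the convex hull of a finite set of points of ℝ², has nonempty interior, and has exactly four extreme points), there exists a locally finite monohedral tiling of ℝ² with prototile Q. -/
open Set

noncomputable section

/-- The gauge of the interval `[-s, 1 - s]`. -/
def intervalGauge (s x : ℝ) : ℝ := max (x / (1 - s)) (-x / s)

lemma intervalGauge_le_iff {s : ℝ} (h0 : 0 < s) (h1 : s < 1) {x r : ℝ} :
    intervalGauge s x ≤ r ↔ x ≤ r * (1 - s) ∧ -x ≤ r * s := by
  rw [intervalGauge, max_le_iff, div_le_iff₀ (by linarith), div_le_iff₀ h0]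

lemma intervalGauge_of_nonneg {s : ℝ} (h0 : 0 < s) (h1 : s < 1) {x : ℝ} (hx : 0 ≤ x) :
    intervalGauge s x = x / (1 - s) := by
  refine max_eq_left ((div_nonpos_of_nonpos_of_nonneg (by linarith) h0.le).trans ?_)
  exact div_nonneg hx (by linarith)

lemma intervalGauge_of_nonpos {s : ℝ} (h0 : 0 < s) (h1 : s < 1) {x : ℝ} (hx : x ≤ 0) :
    intervalGauge s x = -x / s := by
  refine max_eq_right ((div_nonpos_of_nonpos_of_nonneg hx (by linarith)).trans ?_)
  exact div_nonneg (by linarith) h0.le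

lemma intervalGauge_nonneg {s : ℝ} (h0 : 0 < s) (h1 : s < 1) (x : ℝ) :
    0 ≤ intervalGauge s x := by
  rcases le_total 0 x with hx | hx
  · rw [intervalGauge_of_nonneg h0 h1 hx]; exact div_nonneg hx (by linarith)
  · rw [intervalGauge_of_nonpos h0 h1 hx]; exact div_nonneg (by linarith) h0.le

lemma intervalGauge_mul {s r : ℝ} (hr : 0 ≤ r) (x : ℝ) :
    intervalGauge s (r * x) = r * intervalGauge s x := by
  rw [intervalGauge, intervalGauge, mul_max_of_nonneg _ _ hr]
  congr 1 <;> ring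

lemma intervalGauge_convex {s : ℝ} (h0 : 0 < s) (h1 : s < 1) {a b : ℝ} (ha : 0 ≤ a)
    (hb : 0 ≤ b) (x y : ℝ) :
    intervalGauge s (a * x + b * y) ≤ a * intervalGauge s x + b * intervalGauge s y := by
  have hx := (intervalGauge_le_iff h0 h1).1 (le_refl (intervalGauge s x))
  have hy := (intervalGauge_le_iff h0 h1).1 (le_refl (intervalGauge s y))
  rw [intervalGauge_le_iff h0 h1]
  constructor
  · linarith [mul_le_mul_of_nonneg_left hx.1 ha, mul_le_mul_of_nonneg_left hy.1 hb]
  · linarith [mul_le_mul_of_nonneg_left hx.2 ha, mul_le_mul_of_nonneg_left hy.2 hb]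

lemma eq_of_intervalGauge_lt_one {s : ℝ} (h0 : 0 < s) (h1 : s < 1) {x : ℝ} {m n : ℤ}
    (hm : intervalGauge s (x + m) < 1) (hn : intervalGauge s (x + n) < 1) : m = n := by
  rw [intervalGauge, max_lt_iff, div_lt_iff₀ (by linarith), div_lt_iff₀ h0] at hm hn
  have h : (m : ℝ) < n + 1 := by linarith
  have h' : (n : ℝ) < m + 1 := by linarith
  norm_cast at h h'
  lia

lemma one_le_intervalGauge_add_reflect {s : ℝ} (h0 : 0 < s) (h1 : s < 1) (x : ℝ) (k : ℤ) :
    1 ≤ intervalGauge s x + intervalGauge s (k - s - x) := by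
  have hs : 0 < 1 - s := by linarith
  have p1 : ∀ y, y / (1 - s) ≤ intervalGauge s y := fun y => le_max_left _ _
  have p2 : ∀ y, -y / s ≤ intervalGauge s y := fun y => le_max_right _ _
  have n1 := intervalGauge_nonneg h0 h1 x
  have n2 := intervalGauge_nonneg h0 h1 (k - s - x)
  have key : 1 - s ≤ x + (k - s - x) ∨ s ≤ -x + -(k - s - x) := by
    rcases le_or_gt 1 k with hk | hk
    · left
      have : (1 : ℝ) ≤ k := by exact_mod_cast hk
      linarith
    · right
      have : (k : ℝ) ≤ 0 := by exact_mod_cast (by lia : k ≤ 0)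
      linarith
  rcases key with h | h
  · rw [← one_le_div hs, add_div] at h
    linarith [p1 x, p1 (k - s - x)]
  · rw [← one_le_div h0, add_div] at h
    linarith [p2 x, p2 (k - s - x)]

lemma exists_intervalGauge_le_one {s : ℝ} (h0 : 0 < s) (h1 : s < 1) (x : ℝ) :
    ∃ m k : ℤ, intervalGauge s (x + m) + intervalGauge s (k - s - x) = 1 := by
  have hs : 0 < 1 - s := by linarith
  have l1 := Int.floor_le (x + s)
  have l2 := Int.lt_floor_add_one (x + s)
  set n := ⌊x + s⌋
  rcases le_total (n : ℝ) x with hx | hx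
  · refine ⟨-n, n + 1, ?_⟩
    push_cast
    rw [intervalGauge_of_nonneg h0 h1 (by linarith), intervalGauge_of_nonneg h0 h1 (by linarith)]
    field_simp
    ring
  · refine ⟨-n, n, ?_⟩
    push_cast
    rw [intervalGauge_of_nonpos h0 h1 (by linarith), intervalGauge_of_nonpos h0 h1 (by linarith)]
    field_simp
    ring

/-- Translation by a vector of the lattice spanned by `u` and `v`, preceded, for `false`, by the
point reflection `z ↦ w - z`. -/
def tileIsometry {d : ℕ} (u v w : Euc d) (i : Bool × ℤ × ℤ) : Euc d ≃ᵢ Euc d :=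
  if i.1 then IsometryEquiv.addRight ((i.2.1 : ℝ) • u + (i.2.2 : ℝ) • v)
  else (IsometryEquiv.neg _).trans
    (IsometryEquiv.addRight (w + (i.2.1 : ℝ) • u + (i.2.2 : ℝ) • v))

/-- A set cut out in affine coordinates `X`, `Y` by the gauges of two intervals of length one tiles
the plane by translates and point reflections. -/
lemma exists_tiling_of_intervalGauge {Q : Set (Euc 2)} (hQ : IsClosed Q) {u v o : Euc 2}
    {X Y : Euc 2 →L[ℝ] ℝ} (hXu : X u = 1) (hXv : X v = 0) (hYu : Y u = 0) (hYv : Y v = 1)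
    {s t : ℝ} (hs0 : 0 < s) (hs1 : s < 1) (ht0 : 0 < t) (ht1 : t < 1)
    (hmem : ∀ z, z ∈ Q ↔ intervalGauge s (X (z - o)) + intervalGauge t (Y (z - o)) ≤ 1) :
    ∃ 𝒯 : Set (Set (Euc 2)), IsTiling 𝒯 ∧ LocallyFiniteTiling 𝒯 ∧ Monohedral 𝒯 Q := by
  set τ := tileIsometry u v (o + o - s • u - t • v) with hτ
  have hXt : ∀ m n z, X (τ (true, m, n) z - o) = X (z - o) + m := by
    intro m n z
    simp [hτ, tileIsometry, hXu, hXv]; ring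
  have hYt : ∀ m n z, Y (τ (true, m, n) z - o) = Y (z - o) + n := by
    intro m n z
    simp [hτ, tileIsometry, hYu, hYv]; ring
  have hXf : ∀ m n z, X (τ (false, m, n) z - o) = m - s - X (z - o) := by
    intro m n z
    simp [hτ, tileIsometry, hXu, hXv]; ring
  have hYf : ∀ m n z, Y (τ (false, m, n) z - o) = n - t - Y (z - o) := by
    intro m n z
    simp [hτ, tileIsometry, hYu, hYv]; ring
  have hint : ∀ z ∈ interior Q,
      intervalGauge s (X (z - o)) + intervalGauge t (Y (z - o)) < 1 := by
    intro z hz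
    have hc : ContinuousAt (fun r : ℝ => o + r • (z - o)) 1 := by fun_prop
    have hn : ∀ᶠ r in nhds (1 : ℝ), o + r • (z - o) ∈ Q := by
      apply hc
      simpa using mem_interior_iff_mem_nhds.1 hz
    obtain ⟨r, hrQ, hr⟩ :=
      ((hn.filter_mono nhdsWithin_le_nhds).and (self_mem_nhdsWithin (s := Ioi (1 : ℝ)))).exists
    have hr : 1 < r := hr
    rw [hmem] at hrQ
    simp only [add_sub_cancel_left, map_smul, smul_eq_mul] at hrQ
    rw [intervalGauge_mul (by linarith), intervalGauge_mul (by linarith)] at hrQ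
    have h1 := intervalGauge_nonneg hs0 hs1 (X (z - o))
    have h2 := intervalGauge_nonneg ht0 ht1 (Y (z - o))
    nlinarith
  have hdisj : ∀ i j z, τ i z ∈ interior Q → τ j z ∈ interior Q → i = j := by
    have mixed : ∀ m n m' n' z, τ (true, m, n) z ∈ interior Q →
        τ (false, m', n') z ∈ interior Q → False := by
      intro m n m' n' z hi hj
      have hi := hint _ hi
      have hj := hint _ hj
      rw [hXt, hYt] at hi
      rw [hXf, hYf] at hj
      have e1 := one_le_intervalGauge_add_reflect hs0 hs1 (X (z - o) + m) (m' + m)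
      have e2 := one_le_intervalGauge_add_reflect ht0 ht1 (Y (z - o) + n) (n' + n)
      push_cast at e1 e2
      rw [show (m' : ℝ) + m - s - (X (z - o) + m) = m' - s - X (z - o) by ring] at e1
      rw [show (n' : ℝ) + n - t - (Y (z - o) + n) = n' - t - Y (z - o) by ring] at e2
      linarith
    rintro ⟨_ | _, m, n⟩ ⟨_ | _, m', n'⟩ z hi hj
    · have hi := hint _ hi
      have hj := hint _ hj
      rw [hXf, hYf] at hi hj
      have p := intervalGauge_nonneg hs0 hs1
      have q := intervalGauge_nonneg ht0 ht1
      have em : m = m' := by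
        apply eq_of_intervalGauge_lt_one hs0 hs1 (x := -s - X (z - o))
        · rw [show -s - X (z - o) + m = m - s - X (z - o) by ring]
          linarith [q (n - t - Y (z - o))]
        · rw [show -s - X (z - o) + m' = m' - s - X (z - o) by ring]
          linarith [q (n' - t - Y (z - o))]
      have en : n = n' := by
        apply eq_of_intervalGauge_lt_one ht0 ht1 (x := -t - Y (z - o))
        · rw [show -t - Y (z - o) + n = n - t - Y (z - o) by ring]
          linarith [p (m - s - X (z - o))]
        · rw [show -t - Y (z - o) + n' = n' - t - Y (z - o) by ring]
          linarith [p (m' - s - X (z - o))]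
      rw [em, en]
    · exact (mixed _ _ _ _ z hj hi).elim
    · exact (mixed _ _ _ _ z hi hj).elim
    · have hi := hint _ hi
      have hj := hint _ hj
      rw [hXt, hYt] at hi hj
      have p := intervalGauge_nonneg hs0 hs1
      have q := intervalGauge_nonneg ht0 ht1
      have em : m = m' := eq_of_intervalGauge_lt_one hs0 hs1
        (by linarith [q (Y (z - o) + n)]) (by linarith [q (Y (z - o) + n')])
      have en : n = n' := eq_of_intervalGauge_lt_one ht0 ht1
        (by linarith [p (X (z - o) + m)]) (by linarith [p (X (z - o) + m')])
      rw [em, en]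
  refine ⟨range fun i => τ i ⁻¹' Q, ⟨?_, ?_, ?_⟩, ?_, ?_⟩
  · rintro _ ⟨i, rfl⟩
    exact hQ.preimage (τ i).continuous
  · refine eq_univ_of_forall fun z => ?_
    obtain ⟨m, m', hm⟩ := exists_intervalGauge_le_one hs0 hs1 (X (z - o))
    obtain ⟨n, n', hn⟩ := exists_intervalGauge_le_one ht0 ht1 (Y (z - o))
    rcases le_total (intervalGauge s (X (z - o) + m) + intervalGauge t (Y (z - o) + n)) 1
      with h | h
    · refine ⟨_, ⟨(true, m, n), rfl⟩, ?_⟩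
      rw [mem_preimage, hmem, hXt, hYt]
      exact h
    · refine ⟨_, ⟨(false, m', n'), rfl⟩, ?_⟩
      rw [mem_preimage, hmem, hXf, hYf]
      linarith
  · rintro _ ⟨i, rfl⟩ _ ⟨j, rfl⟩ hne
    refine eq_empty_of_forall_notMem fun z hz => hne ?_
    have hpre : ∀ i, interior (τ i ⁻¹' Q) = τ i ⁻¹' interior Q := fun i =>
      ((τ i).toHomeomorph.preimage_interior Q).symm
    rw [hpre, hpre] at hz
    rw [hdisj i j z hz.1 hz.2]
  · intro K hK
    obtain ⟨a, ha⟩ := (hK.image (f := fun z => X (z - o)) (by fun_prop)).isBounded.exists_norm_le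
    obtain ⟨b, hb⟩ := (hK.image (f := fun z => Y (z - o)) (by fun_prop)).isBounded.exists_norm_le
    obtain ⟨N, hN⟩ := exists_nat_gt (max a b + 2)
    have hfin : (univ ×ˢ (Icc (-N : ℤ) N ×ˢ Icc (-N : ℤ) N) : Set (Bool × ℤ × ℤ)).Finite :=
      finite_univ.prod ((finite_Icc _ _).prod (finite_Icc _ _))
    refine (hfin.image fun i => τ i ⁻¹' Q).subset ?_
    rintro _ ⟨⟨i, rfl⟩, z, hzQ, hzK⟩
    refine ⟨i, ?_, rfl⟩
    have hza := abs_le.1 (ha _ (mem_image_of_mem _ hzK))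
    have hzb := abs_le.1 (hb _ (mem_image_of_mem _ hzK))
    have hab := le_max_left a b
    have hba := le_max_right a b
    rw [mem_preimage, hmem] at hzQ
    have hX := (intervalGauge_le_iff hs0 hs1).1
      ((le_add_of_nonneg_right (intervalGauge_nonneg ht0 ht1 _)).trans hzQ)
    have hY := (intervalGauge_le_iff ht0 ht1).1
      ((le_add_of_nonneg_left (intervalGauge_nonneg hs0 hs1 _)).trans hzQ)
    have cast_mem : ∀ m : ℤ, -(N : ℝ) ≤ m → (m : ℝ) ≤ N → m ∈ Icc (-N : ℤ) N :=
      fun m h h' => ⟨by exact_mod_cast h, by exact_mod_cast h'⟩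
    obtain ⟨_ | _, m, n⟩ := i
    · rw [hXf] at hX
      rw [hYf] at hY
      exact ⟨mem_univ _, cast_mem m (by linarith) (by linarith),
        cast_mem n (by linarith) (by linarith)⟩
    · rw [hXt] at hX
      rw [hYt] at hY
      exact ⟨mem_univ _, cast_mem m (by linarith) (by linarith),
        cast_mem n (by linarith) (by linarith)⟩
  · rintro _ ⟨i, rfl⟩
    exact ⟨(τ i).symm, (τ i).image_symm ▸ rfl⟩

/-- Among four points of the plane in convex position, some two pairs span crossing segments. -/
lemma exists_crossing_diagonals {E : Set (Euc 2)} (hE : E.ncard = 4)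
    (hext : ∀ a ∈ E, a ∉ convexHull ℝ (E \ {a})) :
    ∃ a b c d : Euc 2, E = {a, b, c, d} ∧ (openSegment ℝ a c ∩ openSegment ℝ b d).Nonempty := by
  have hEfin : E.Finite := finite_of_ncard_ne_zero (by lia)
  have : Fintype E := hEfin.fintype
  have hcard : Fintype.card E = 4 := by
    rw [← Nat.card_eq_fintype_card, Nat.card_coe_set_eq, hE]
  have hdep : ¬ AffineIndependent ℝ ((↑) : E → Euc 2) := by
    intro h
    have := h.card_le_finrank_succ
    have h2 := Submodule.finrank_le (vectorSpan ℝ (range ((↑) : E → Euc 2)))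
    rw [finrank_euclideanSpace_fin] at h2
    lia
  obtain ⟨I, o, hoI, hoJ⟩ := Convex.radon_partition hdep
  set P : Set (Euc 2) := (↑) '' I with hP
  have hJ : ((↑) '' Iᶜ : Set (Euc 2)) = E \ P := by
    rw [image_compl_eq_range_sdiff_image Subtype.val_injective, Subtype.range_coe]
  have hPE : P ⊆ E := by rintro _ ⟨x, -, rfl⟩; exact x.2
  rw [hJ] at hoJ
  have hadd := ncard_sdiff_add_ncard_of_subset hPE hEfin
  rw [hE] at hadd
  have hcase : ∀ R ⊆ E, o ∈ convexHull ℝ R → o ∈ convexHull ℝ (E \ R) → 2 ≤ R.ncard := by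
    intro R hRE h1 h2
    by_contra! h
    have hRfin := hEfin.subset hRE
    rcases (ncard_le_one_iff_eq hRfin).1 (by lia) with rfl | ⟨a, rfl⟩
    · simp at h1
    · rw [convexHull_singleton] at h1
      rw [mem_singleton_iff.1 h1] at h2
      exact hext a (hRE rfl) h2
  have h1 := hcase P hPE hoI hoJ
  have h2 := hcase (E \ P) sdiff_subset hoJ (by rwa [sdiff_sdiff_cancel_left hPE])
  obtain ⟨a, c, hac, hPac⟩ := ncard_eq_two.1 (by omega : P.ncard = 2)
  obtain ⟨b, d, hbd, hJbd⟩ := ncard_eq_two.1 (by omega : (E \ P).ncard = 2)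
  have hEq : E = {a, c} ∪ {b, d} := by rw [← hPac, ← hJbd, union_sdiff_cancel hPE]
  rw [hPac, convexHull_pair] at hoI
  rw [hJbd, convexHull_pair] at hoJ
  have hdis : Disjoint ({a, c} : Set (Euc 2)) {b, d} := by
    rw [← hPac, ← hJbd]; exact disjoint_sdiff_right
  have avoid : ∀ x p q, x ∈ E → p ∈ E → q ∈ E → x ≠ p → x ≠ q → x ∉ segment ℝ p q := by
    intro x p q hx hp hq hxp hxq h
    refine hext x hx (convexHull_mono (s := {p, q}) ?_ (by rwa [convexHull_pair]))
    rintro y (rfl | rfl)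
    · exact ⟨hp, hxp.symm⟩
    · exact ⟨hq, hxq.symm⟩
  have haE : a ∈ E := by simp [hEq]
  have hbE : b ∈ E := by simp [hEq]
  have hcE : c ∈ E := by simp [hEq]
  have hdE : d ∈ E := by simp [hEq]
  simp only [disjoint_insert_left, disjoint_singleton_left, mem_insert_iff, mem_singleton_iff,
    not_or] at hdis
  obtain ⟨⟨hab, had⟩, hcb, hcd⟩ := hdis
  refine ⟨a, b, c, d, ?_, o, ?_, ?_⟩
  · rw [hEq]; ext x; simp; tauto
  · refine mem_openSegment_of_ne_left_right ?_ ?_ hoI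
    · rintro rfl; exact avoid _ b d haE hbE hdE hab had hoJ
    · rintro rfl; exact avoid _ b d hcE hbE hdE hcb hcd hoJ
  · refine mem_openSegment_of_ne_left_right ?_ ?_ hoJ
    · rintro rfl; exact avoid _ a c hbE haE hcE (Ne.symm hab) (Ne.symm hcb) hoI
    · rintro rfl; exact avoid _ a c hdE haE hcE (Ne.symm had) (Ne.symm hcd) hoI

lemma mem_convexHull_iff_intervalGauge {u v o : Euc 2} {X Y : Euc 2 →L[ℝ] ℝ}
    (hXu : X u = 1) (hXv : X v = 0) (hYu : Y u = 0) (hYv : Y v = 1)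
    (hXY : ∀ z, z = X z • u + Y z • v)
    {s t : ℝ} (hs0 : 0 < s) (hs1 : s < 1) (ht0 : 0 < t) (ht1 : t < 1) (z : Euc 2) :
    z ∈ convexHull ℝ {o - s • u, o - t • v, o + (1 - s) • u, o + (1 - t) • v} ↔
      intervalGauge s (X (z - o)) + intervalGauge t (Y (z - o)) ≤ 1 := by
  set H := convexHull ℝ {o - s • u, o - t • v, o + (1 - s) • u, o + (1 - t) • v}
  constructor
  · intro hz
    have hconv : Convex ℝ {z : Euc 2 |
        intervalGauge s (X (z - o)) + intervalGauge t (Y (z - o)) ≤ 1} := by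
      intro x hx y hy a b ha hb hab
      rw [mem_ofPred_eq] at hx hy ⊢
      have hsub : a • x + b • y - o = a • (x - o) + b • (y - o) := by
        obtain rfl : b = 1 - a := by linarith
        module
      rw [hsub, map_add, map_add, map_smul, map_smul, map_smul, map_smul]
      simp only [smul_eq_mul]
      have e1 := intervalGauge_convex hs0 hs1 ha hb (X (x - o)) (X (y - o))
      have e2 := intervalGauge_convex ht0 ht1 ha hb (Y (x - o)) (Y (y - o))
      nlinarith
    refine convexHull_min ?_ hconv hz
    have g0 : ∀ r, intervalGauge r 0 = 0 := fun r => by simp [intervalGauge]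
    have gs : ∀ r, 0 < r → r < 1 → intervalGauge r (-r) = 1 := fun r h0 h1 => by
      rw [intervalGauge_of_nonpos h0 h1 (by linarith), neg_neg, div_self h0.ne']
    have gs' : ∀ r, 0 < r → r < 1 → intervalGauge r (1 - r) = 1 := fun r h0 h1 => by
      rw [intervalGauge_of_nonneg h0 h1 (by linarith), div_self (by linarith)]
    have q1 := gs s hs0 hs1
    have q2 := gs t ht0 ht1
    have q3 := gs' s hs0 hs1
    have q4 := gs' t ht0 ht1
    rintro _ (rfl | rfl | rfl | rfl) <;>
      simp [hXu, hXv, hYu, hYv, g0, q1, q2, q3, q4]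
  · intro hz
    have hHc : Convex ℝ H := convex_convexHull ℝ _
    have hsubset := subset_convexHull ℝ
      ({o - s • u, o - t • v, o + (1 - s) • u, o + (1 - t) • v} : Set (Euc 2))
    have hA : o - s • u ∈ H := hsubset (by simp)
    have hB : o - t • v ∈ H := hsubset (by simp)
    have hC : o + (1 - s) • u ∈ H := hsubset (by simp)
    have hD : o + (1 - t) • v ∈ H := hsubset (by simp)
    have ho : o ∈ H := by
      have := hHc hA hC (by linarith : 0 ≤ 1 - s) hs0.le (by ring)
      convert this using 1
      module
    have direction : ∀ {r : ℝ} (w : Euc 2), 0 < r → r < 1 → o - r • w ∈ H →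
        o + (1 - r) • w ∈ H → ∀ x : ℝ, ∃ p ∈ H, intervalGauge r x • (p - o) = x • w := by
      intro r w h0 h1 hl hr x
      have h1' : 1 - r ≠ 0 := by linarith
      rcases le_total 0 x with hx | hx
      · refine ⟨_, hr, ?_⟩
        rw [intervalGauge_of_nonneg h0 h1 hx, add_sub_cancel_left, smul_smul,
          div_mul_cancel₀ _ h1']
      · refine ⟨_, hl, ?_⟩
        rw [intervalGauge_of_nonpos h0 h1 hx, sub_sub_cancel_left, smul_neg, smul_smul,
          div_mul_cancel₀ _ h0.ne', neg_smul, neg_neg]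
    obtain ⟨p, hp, hpe⟩ := direction u hs0 hs1 hA hC (X (z - o))
    obtain ⟨q, hq, hqe⟩ := direction v ht0 ht1 hB hD (Y (z - o))
    have n1 := intervalGauge_nonneg hs0 hs1 (X (z - o))
    have n2 := intervalGauge_nonneg ht0 ht1 (Y (z - o))
    have hz' := hXY (z - o)
    rw [← hpe, ← hqe] at hz'
    generalize intervalGauge s (X (z - o)) = α at *
    generalize intervalGauge t (Y (z - o)) = β at *
    have hsum := hHc.sum_mem (t := Finset.univ) (w := ![1 - α - β, α, β]) (z := ![o, p, q])
      (by intro i _; fin_cases i <;> simp <;> linarith)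
      (by simp [Fin.sum_univ_three]; ring)
      (by intro i _; fin_cases i <;> simpa)
    have : z = (1 - α - β) • o + α • p + β • q := by
      rw [← sub_add_cancel z o, hz']; module
    rw [this]
    simpa [Fin.sum_univ_three] using hsum

/-- every convex quadrilateral tiles the plane. -/
theorem quadrilateral_is_plane_filler (Q : Set (Euc 2))
    (hcomp : IsCompact Q) (hconv : Convex ℝ Q)
    (hpoly : ∃ V : Finset (Euc 2), Q = convexHull ℝ (V : Set (Euc 2)))
    (hint : (interior Q).Nonempty)
    (hfour : (Set.extremePoints ℝ Q).ncard = 4) :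
    ∃ 𝒯 : Set (Set (Euc 2)), IsTiling 𝒯 ∧ LocallyFiniteTiling 𝒯 ∧ Monohedral 𝒯 Q := by
  have hfin : (extremePoints ℝ Q).Finite := finite_of_ncard_ne_zero (by simp [hfour])
  have hQ : Q = convexHull ℝ (extremePoints ℝ Q) := by
    rw [← (hfin.isClosed_convexHull ℝ).closure_eq]
    exact (closure_convexHull_extremePoints hcomp hconv).symm
  obtain ⟨a, b, c, d, hE, o, ⟨s', s, hs', hs, hss, hos⟩, t', t, ht', ht, htt, hot⟩ :=
    exists_crossing_diagonals hfour fun a ha h => by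
      have := (hconv.mem_extremePoints_iff_mem_sdiff_convexHull_sdiff.1 ha).2
      exact this (convexHull_mono (sdiff_subset_sdiff_left extremePoints_subset) h)
  obtain rfl : s' = 1 - s := by linarith
  obtain rfl : t' = 1 - t := by linarith
  have ea : a = o - s • (c - a) := by rw [← hos]; module
  have ec : c = o + (1 - s) • (c - a) := by rw [← hos]; module
  have eb : b = o - t • (d - b) := by rw [← hot]; module
  have ed : d = o + (1 - t) • (d - b) := by rw [← hot]; module
  generalize c - a = u at ea ec
  generalize d - b = v at eb ed
  subst ea eb ec ed
  rw [hE] at hQ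
  have hspan : (⊤ : Submodule ℝ (Euc 2)) ≤ Submodule.span ℝ (range ![u, v]) := by
    rw [hQ, interior_convexHull_nonempty_iff_affineSpan_eq_top] at hint
    have hle : affineSpan ℝ {o - s • u, o - t • v, o + (1 - s) • u, o + (1 - t) • v} ≤
        AffineSubspace.mk' o (Submodule.span ℝ (range ![u, v])) := by
      have hu : u ∈ Submodule.span ℝ (range ![u, v]) := Submodule.subset_span ⟨0, rfl⟩
      have hv : v ∈ Submodule.span ℝ (range ![u, v]) := Submodule.subset_span ⟨1, rfl⟩
      rw [affineSpan_le]
      rintro _ (rfl | rfl | rfl | rfl) <;>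
        simp only [SetLike.mem_coe, AffineSubspace.mem_mk', vsub_eq_sub, sub_sub_cancel_left,
          add_sub_cancel_left, neg_mem_iff] <;>
        exact Submodule.smul_mem _ _ (by assumption)
    rw [hint, top_le_iff] at hle
    rw [← AffineSubspace.direction_mk' o (Submodule.span ℝ (range ![u, v])), hle,
      AffineSubspace.direction_top]
  have hli : LinearIndependent ℝ ![u, v] :=
    linearIndependent_of_top_le_span_of_card_eq_finrank hspan (by simp)
  let B := Module.Basis.mk hli hspan
  have hB0 : B 0 = u := by simp [B]
  have hB1 : B 1 = v := by simp [B]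
  let X : Euc 2 →L[ℝ] ℝ := LinearMap.toContinuousLinearMap (B.coord 0)
  let Y : Euc 2 →L[ℝ] ℝ := LinearMap.toContinuousLinearMap (B.coord 1)
  have hXu : X u = 1 := by simp [X, ← hB0]
  have hXv : X v = 0 := by simp [X, ← hB1]
  have hYu : Y u = 0 := by simp [Y, ← hB0]
  have hYv : Y v = 1 := by simp [Y, ← hB1]
  have hXY : ∀ z, z = X z • u + Y z • v := fun z => by
    have := (B.sum_repr z).symm
    rwa [Fin.sum_univ_two, hB0, hB1] at this
  refine exists_tiling_of_intervalGauge (o := o) hcomp.isClosed hXu hXv hYu hYv hs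
    (by linarith) ht (by linarith) fun z => ?_
  rw [hQ]
  exact mem_convexHull_iff_intervalGauge hXu hXv hYu hYv hXY hs (by linarith) ht
    (by linarith) z
end
end

section
/- If a convex polygon P in ℝ² is the prototile of a locally finite monohedral tiling of ℝ² (i.e., P is a convex plane-filler), then P has at most 6 extreme points; in other words, every convex plane-filler is a triangle, quadrangle, pentagon or hexagon. -/
open Set

noncomputable section

open MeasureTheory Topology

/-- The planar cross product `x ∧ y`. -/
def cross (x y : Euc 2) : ℝ := x 0 * y 1 - x 1 * y 0

lemma cross_smul_sub_smul (x y z : Euc 2) :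
    cross x y • z - cross x z • y = -cross y z • x := by
  ext i
  fin_cases i <;> simp [cross] <;> ring

lemma cross_smul_right (x y : Euc 2) (t : ℝ) : cross x (t • y) = t * cross x y := by
  simp [cross]; ring

lemma cross_neg_left (x y : Euc 2) : cross (-x) y = -cross x y := by
  simp [cross]; ring

lemma cross_neg_right (x y : Euc 2) : cross x (-y) = -cross x y := by
  simp [cross]; ring

@[fun_prop]
lemma Continuous.cross {X : Type*} [TopologicalSpace X] {f g : X → Euc 2}
    (hf : Continuous f) (hg : Continuous g) : Continuous fun p => cross (f p) (g p) := by
  unfold _root_.cross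
  fun_prop

lemma volume_cross_eq_zero {w : Euc 2} (hw : w ≠ 0) :
    volume {y : Euc 2 | cross y w = 0} = 0 := by
  let φ : Euc 2 →ₗ[ℝ] ℝ :=
    { toFun := fun y => cross y w
      map_add' := by intro x y; simp [cross]; ring
      map_smul' := by intro c x; simp [cross]; ring }
  have h : LinearMap.ker φ ≠ ⊤ := by
    intro h
    apply hw
    rw [LinearMap.ker_eq_top] at h
    have h0 : φ (!₂[1, 0]) = 0 := by rw [h]; rfl
    have h1 : φ (!₂[0, 1]) = 0 := by rw [h]; rfl
    simp [φ, cross] at h0 h1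
    ext i
    fin_cases i <;> simp [h0, h1]
  exact Measure.addHaar_submodule volume _ h

/-- The uniform probability measure on the unit disc. The measure of a cone with apex `0` is its
angle in units of a full turn. -/
def discMeasure : Measure (Euc 2) := ProbabilityTheory.cond volume (Metric.ball 0 1)

instance : IsProbabilityMeasure discMeasure :=
  ProbabilityTheory.cond_isProbabilityMeasure_of_finite
    (Metric.measure_ball_pos volume _ one_pos).ne' measure_ball_lt_top.ne

lemma discMeasure_null {s : Set (Euc 2)} (h : volume s = 0) : discMeasure s = 0 :=
  ProbabilityTheory.cond_absolutelyContinuous h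

lemma discMeasure_real_neg (s : Set (Euc 2)) : discMeasure.real (-s) = discMeasure.real s := by
  have : Metric.ball (0 : Euc 2) 1 ∩ -s = -(Metric.ball 0 1 ∩ s) := by
    ext x; simp
  rw [Measure.real, Measure.real, discMeasure,
    ProbabilityTheory.cond_apply measurableSet_ball, ProbabilityTheory.cond_apply measurableSet_ball,
    this, Measure.measure_neg]

lemma discMeasure_real_pos {U : Set (Euc 2)} (hU : IsOpen U) (hne : U.Nonempty)
    (hcone : ∀ x ∈ U, ∀ t : ℝ, 0 < t → t • x ∈ U) : 0 < discMeasure.real U := by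
  obtain ⟨x, hx⟩ := hne
  have hpos : 0 < volume (Metric.ball (0 : Euc 2) 1 ∩ U) := by
    refine (Metric.isOpen_ball.inter hU).measure_pos _ ⟨(‖x‖ + 1)⁻¹ • x, ?_, ?_⟩
    · have : 0 < ‖x‖ + 1 := by positivity
      rw [mem_ball_zero_iff, norm_smul, norm_inv, Real.norm_of_nonneg this.le,
        inv_mul_lt_iff₀ this]
      linarith
    · exact hcone x hx _ (by positivity)
  rw [measureReal_def, ENNReal.toReal_pos_iff]
  refine ⟨?_, measure_lt_top _ _⟩
  rw [discMeasure, ProbabilityTheory.cond_apply measurableSet_ball]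
  exact ENNReal.mul_pos (ENNReal.inv_ne_zero.2 measure_ball_lt_top.ne) hpos.ne'

/-- The cone of directions pointing from `v` into the interior of `T`. -/
def inwardCone (T : Set (Euc 2)) (v : Euc 2) : Set (Euc 2) :=
  {x | ∃ t : ℝ, 0 < t ∧ v + t • x ∈ interior T}

/-- The normal cone of `T` at `v`, turned by a right angle. -/
def turnedNormalCone (T : Set (Euc 2)) (v : Euc 2) : Set (Euc 2) :=
  {y | ∀ x ∈ T, cross y (x - v) ≤ 0}

/-- The angle of `T` at `v`, in units of a full turn. -/
def turnAngle (T : Set (Euc 2)) (v : Euc 2) : ℝ := discMeasure.real (inwardCone T v)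

section Cones

variable {T : Set (Euc 2)} {v : Euc 2}

lemma isOpen_inwardCone : IsOpen (inwardCone T v) := by
  have : inwardCone T v = ⋃ t : ℝ, ⋃ _ : 0 < t, (fun x => v + t • x) ⁻¹' interior T := by
    ext x; simp [inwardCone]
  rw [this]
  exact isOpen_iUnion fun t => isOpen_iUnion fun _ => isOpen_interior.preimage (by fun_prop)

lemma smul_mem_inwardCone {x : Euc 2} (hx : x ∈ inwardCone T v) {s : ℝ} (hs : 0 < s) :
    s • x ∈ inwardCone T v := by
  obtain ⟨t, ht, h⟩ := hx
  refine ⟨t / s, by positivity, ?_⟩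
  rwa [smul_smul, div_mul_cancel₀ _ hs.ne']

lemma sub_mem_inwardCone {x : Euc 2} (hx : x ∈ interior T) : x - v ∈ inwardCone T v :=
  ⟨1, one_pos, by simpa using hx⟩

lemma add_smul_mem_interior_of_le (hT : Convex ℝ T) (hv : v ∈ T) {x : Euc 2} {s t : ℝ}
    (hs : 0 < s) (hst : s ≤ t) (hx : v + t • x ∈ interior T) : v + s • x ∈ interior T := by
  have ht : 0 < t := hs.trans_le hst
  have h := hT.combo_interior_self_mem_interior hx hv (a := s / t) (b := 1 - s / t)
    (by positivity) (by rw [sub_nonneg, div_le_one ht]; exact hst) (by ring)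
  convert h using 1
  rw [smul_add, smul_smul, div_mul_cancel₀ _ ht.ne']
  module

lemma add_mem_inwardCone (hT : Convex ℝ T) (hv : v ∈ T) {x y : Euc 2}
    (hx : x ∈ inwardCone T v) (hy : y ∈ inwardCone T v) : x + y ∈ inwardCone T v := by
  obtain ⟨s, hs, hx⟩ := hx
  obtain ⟨t, ht, hy⟩ := hy
  have hr : 0 < min s t := lt_min hs ht
  refine ⟨min s t / 2, by positivity, ?_⟩
  have h := hT.interior (add_smul_mem_interior_of_le hT hv hr (min_le_left _ _) hx)
    (add_smul_mem_interior_of_le hT hv hr (min_le_right _ _) hy)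
    (a := 1 / 2) (b := 1 / 2) (by norm_num) (by norm_num) (by norm_num)
  convert h using 1
  module

lemma convex_inwardCone (hT : Convex ℝ T) (hv : v ∈ T) : Convex ℝ (inwardCone T v) := by
  rw [convex_iff_forall_pos]
  intro x hx y hy a b ha hb _
  exact add_mem_inwardCone hT hv (smul_mem_inwardCone hx ha) (smul_mem_inwardCone hy hb)

lemma zero_notMem_inwardCone (h : v ∉ interior T) : (0 : Euc 2) ∉ inwardCone T v := by
  rintro ⟨t, -, ht⟩
  simp at ht
  exact h ht

lemma disjoint_inwardCone_neg (hT : Convex ℝ T) (hv : v ∈ T) (h : v ∉ interior T) :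
    Disjoint (inwardCone T v) (-inwardCone T v) := by
  rw [Set.disjoint_left]
  intro x hx hx'
  have := add_mem_inwardCone hT hv hx hx'
  rw [add_neg_cancel] at this
  exact zero_notMem_inwardCone h this

lemma discMeasure_inwardCone_union_neg (hT : Convex ℝ T) (hv : v ∈ T) (h : v ∉ interior T) :
    discMeasure.real (inwardCone T v ∪ -inwardCone T v) = 2 * turnAngle T v := by
  rw [measureReal_union (disjoint_inwardCone_neg hT hv h) isOpen_inwardCone.neg.measurableSet,
    discMeasure_real_neg, turnAngle]
  ring

lemma turnAngle_le_half (hT : Convex ℝ T) (hv : v ∈ T) (h : v ∉ interior T) :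
    turnAngle T v ≤ 1 / 2 := by
  have := discMeasure_inwardCone_union_neg hT hv h
  have h1 : discMeasure.real (inwardCone T v ∪ -inwardCone T v) ≤ 1 := measureReal_le_one
  linarith

lemma half_le_turnAngle_add (hT : Convex ℝ T) (hi : (interior T).Nonempty) (hv : v ∈ T)
    (h : v ∉ interior T) :
    1 / 2 ≤ turnAngle T v + discMeasure.real (turnedNormalCone T v) := by
  set D := inwardCone T v with hD
  set N := turnedNormalCone T v with hN
  have hcl : T ⊆ closure (interior T) := by
    rw [hT.closure_interior_eq_closure_of_nonempty_interior hi]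
    exact subset_closure
  have key : ∀ y : Euc 2, y ∉ N → ∃ e ∈ D, 0 < cross y e := by
    intro y hy
    simp only [hN, turnedNormalCone, mem_ofPred_eq, not_forall, not_le] at hy
    obtain ⟨x, hxT, hx⟩ := hy
    have hopen : IsOpen {x : Euc 2 | 0 < cross y (x - v)} :=
      isOpen_lt continuous_const (by fun_prop)
    obtain ⟨z, hz, hzT⟩ := mem_closure_iff.1 (hcl hxT) _ hopen hx
    exact ⟨z - v, sub_mem_inwardCone hzT, hz⟩
  have hcover : (univ : Set (Euc 2)) ⊆ (D ∪ -D) ∪ (N ∪ -N) := by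
    intro y _
    by_contra hy
    simp only [mem_union, not_or, Set.mem_neg] at hy
    obtain ⟨⟨hyD, hyD'⟩, hyN, hyN'⟩ := hy
    obtain ⟨e, he, hye⟩ := key y hyN
    obtain ⟨f, hf, hyf⟩ := key (-y) hyN'
    rw [cross_neg_left] at hyf
    have hz : -cross e f • y ∈ D := by
      rw [← cross_smul_sub_smul, sub_eq_add_neg, ← neg_smul]
      exact add_mem_inwardCone hT hv (smul_mem_inwardCone hf hye) (smul_mem_inwardCone he hyf)
    rcases lt_trichotomy (-cross e f) 0 with hc | hc | hc
    · apply hyD'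
      convert smul_mem_inwardCone hz (s := -(-cross e f)⁻¹) (by simpa using hc) using 1
      rw [smul_smul, neg_mul, inv_mul_cancel₀ hc.ne, neg_one_smul]
    · rw [hc, zero_smul] at hz
      exact zero_notMem_inwardCone h hz
    · apply hyD
      convert smul_mem_inwardCone hz (s := (-cross e f)⁻¹) (by positivity) using 1
      rw [smul_smul, inv_mul_cancel₀ hc.ne', one_smul]
  have h1 : (1 : ℝ) ≤ discMeasure.real ((D ∪ -D) ∪ (N ∪ -N)) := by
    rw [← probReal_univ (μ := discMeasure)]
    exact measureReal_mono hcover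
  have h2 := measureReal_union_le (μ := discMeasure) (D ∪ -D) (N ∪ -N)
  have h3 := measureReal_union_le (μ := discMeasure) D (-D)
  have h4 := measureReal_union_le (μ := discMeasure) N (-N)
  rw [discMeasure_real_neg] at h3 h4
  rw [turnAngle]
  linarith

lemma half_le_turnAngle_of_notMem_extremePoints (hT : Convex ℝ T) (hi : (interior T).Nonempty)
    (hv : v ∈ T) (h : v ∉ interior T) (hext : v ∉ T.extremePoints ℝ) :
    1 / 2 ≤ turnAngle T v := by
  have h0 := half_le_turnAngle_add hT hi hv h
  suffices discMeasure.real (turnedNormalCone T v) = 0 by linarith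
  rw [mem_extremePoints_iff_left] at hext
  push Not at hext
  obtain ⟨a, ha, b, hb, hvab, hav⟩ := hext hv
  rw [measureReal_eq_zero_iff]
  refine discMeasure_null (measure_mono_null ?_ (volume_cross_eq_zero (sub_ne_zero.2 hav)))
  intro y hy
  obtain ⟨s, t, hs, ht, hst, rfl⟩ := hvab
  set v := s • a + t • b
  have hb' : b - v = -(s / t) • (a - v) := by
    have hs' : s = 1 - t := by linarith
    have : t • (b - v) = t • (-(s / t) • (a - v)) := by
      rw [smul_smul, mul_neg, mul_div_cancel₀ _ ht.ne']
      simp only [v, hs']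
      module
    exact smul_right_injective _ ht.ne' this
  have h1 := hy a ha
  have h2 := hy b hb
  rw [hb', cross_smul_right, neg_mul, neg_nonpos] at h2
  exact le_antisymm h1 (nonneg_of_mul_nonneg_right h2 (by positivity))

end Cones

lemma extremePoints_notMem_interior {T : Set (Euc 2)} {v : Euc 2}
    (hv : v ∈ T.extremePoints ℝ) : v ∉ interior T := fun h =>
  Set.disjoint_left.1 (disjoint_interior_extremePoints T) h hv

/-- At an extreme point, a polytope lies in a cone strictly smaller than a half-plane. -/
lemma exists_forall_mul_norm_le {V : Finset (Euc 2)} {v : Euc 2}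
    (hv : v ∈ (convexHull ℝ (V : Set (Euc 2))).extremePoints ℝ) :
    ∃ f : Euc 2 →L[ℝ] ℝ, ∃ c : ℝ, 0 < c ∧
      ∀ x ∈ convexHull ℝ (V : Set (Euc 2)), c * ‖x - v‖ ≤ f (x - v) := by
  have hsep : v ∉ convexHull ℝ ((V : Set (Euc 2)) \ {v}) := by
    have hsub : convexHull ℝ ((V : Set (Euc 2)) \ {v}) ⊆
        convexHull ℝ (V : Set (Euc 2)) \ {v} :=
      convexHull_min (sdiff_subset_sdiff_left (subset_convexHull ℝ _))
        (((convex_convexHull ℝ _).mem_extremePoints_iff_convex_sdiff).1 hv).2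
    exact fun h => (hsub h).2 rfl
  have hclosed : IsClosed (convexHull ℝ ((V : Set (Euc 2)) \ {v})) :=
    (V.finite_toSet.subset sdiff_subset).isClosed_convexHull ℝ
  obtain ⟨f, u, hfv, hfu⟩ := geometric_hahn_banach_point_closed (convex_convexHull ℝ _) hclosed hsep
  have hM : 0 ≤ ∑ w ∈ V, ‖w - v‖ := by positivity
  have hu : 0 < u - f v := sub_pos.2 hfv
  have hc : 0 < (u - f v) / (∑ w ∈ V, ‖w - v‖ + 1) := by positivity
  refine ⟨f, _, hc, ?_⟩
  generalize hcdef : (u - f v) / (∑ w ∈ V, ‖w - v‖ + 1) = c at hc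
  have hsub : convexHull ℝ (V : Set (Euc 2)) ⊆ {x | c * ‖x - v‖ ≤ f (x - v)} := by
    refine convexHull_min ?_ ?_
    · intro w hw
      rcases eq_or_ne w v with rfl | hne
      · simp
      · have h1 := hfu w (subset_convexHull ℝ _ ⟨hw, hne⟩)
        have h2 : ‖w - v‖ ≤ ∑ w ∈ V, ‖w - v‖ :=
          Finset.single_le_sum (f := fun w => ‖w - v‖) (fun _ _ => norm_nonneg _) hw
        have h3 : c * (∑ w ∈ V, ‖w - v‖ + 1) = u - f v := by
          rw [← hcdef]; field_simp
        simp only [mem_ofPred_eq, map_sub]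
        nlinarith
    · intro x hx y hy a b ha hb hab
      simp only [mem_ofPred_eq] at hx hy ⊢
      have hz : a • x + b • y - v = a • (x - v) + b • (y - v) := by
        have hb' : b = 1 - a := by linarith
        subst hb'
        module
      rw [hz, map_add, map_smul, map_smul, smul_eq_mul, smul_eq_mul]
      have hn : ‖a • (x - v) + b • (y - v)‖ ≤ a * ‖x - v‖ + b * ‖y - v‖ := by
        refine (norm_add_le _ _).trans ?_
        rw [norm_smul, norm_smul, Real.norm_of_nonneg ha, Real.norm_of_nonneg hb]
      calc c * ‖a • (x - v) + b • (y - v)‖ ≤ c * (a * ‖x - v‖ + b * ‖y - v‖) := by gcongr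
        _ = a * (c * ‖x - v‖) + b * (c * ‖y - v‖) := by ring
        _ ≤ _ := by gcongr
  exact fun x hx => hsub hx

lemma turnAngle_lt_half {V : Finset (Euc 2)} {v : Euc 2}
    (hv : v ∈ (convexHull ℝ (V : Set (Euc 2))).extremePoints ℝ) :
    turnAngle (convexHull ℝ (V : Set (Euc 2))) v < 1 / 2 := by
  obtain ⟨f, c, hc, hf⟩ := exists_forall_mul_norm_le hv
  set T := convexHull ℝ (V : Set (Euc 2)) with hT
  have hD : ∀ x ∈ inwardCone T v, c * ‖x‖ ≤ f x := by
    rintro x ⟨t, ht, hx⟩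
    have := hf _ (interior_subset hx)
    rw [add_sub_cancel_left, norm_smul, map_smul, Real.norm_of_nonneg ht.le, smul_eq_mul] at this
    nlinarith
  set U : Set (Euc 2) := {x | |f x| < c * ‖x‖} with hU
  have hUopen : IsOpen U := isOpen_lt (by fun_prop) (by fun_prop)
  have hUpos : 0 < discMeasure.real U := by
    refine discMeasure_real_pos hUopen ?_ ?_
    · have hker : LinearMap.ker (f : Euc 2 →ₗ[ℝ] ℝ) ≠ ⊥ :=
        LinearMap.ker_ne_bot_of_finrank_lt (by simp)
      obtain ⟨x, hx, hx0⟩ := Submodule.exists_mem_ne_zero_of_ne_bot hker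
      refine ⟨x, ?_⟩
      have hfx : f x = 0 := hx
      simp only [hU, mem_ofPred_eq, hfx, abs_zero]
      positivity
    · intro x hx t ht
      simp only [hU, mem_ofPred_eq, map_smul, smul_eq_mul, abs_mul, norm_smul,
        Real.norm_eq_abs, abs_of_pos ht] at hx ⊢
      nlinarith
  have hvT : v ∈ T := hv.1
  have hdis : Disjoint (inwardCone T v ∪ -inwardCone T v) U := by
    rw [Set.disjoint_left]
    rintro x (hx | hx) hxU
    · have := hD x hx
      have h2 : |f x| < c * ‖x‖ := hxU
      linarith [le_abs_self (f x)]
    · have := hD (-x) hx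
      rw [norm_neg, map_neg] at this
      have h2 : |f x| < c * ‖x‖ := hxU
      linarith [neg_abs_le (f x)]
  have h1 := discMeasure_inwardCone_union_neg (convex_convexHull ℝ _) hvT
    (extremePoints_notMem_interior hv)
  have h2 := measureReal_union (μ := discMeasure) hdis hUopen.measurableSet
  have h3 : discMeasure.real (inwardCone T v ∪ -inwardCone T v ∪ U) ≤ 1 := measureReal_le_one
  linarith

lemma isClosed_turnedNormalCone (T : Set (Euc 2)) (v : Euc 2) :
    IsClosed (turnedNormalCone T v) := by
  have : turnedNormalCone T v = ⋂ x ∈ T, {y | cross y (x - v) ≤ 0} := by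
    ext y; simp [turnedNormalCone]
  rw [this]
  exact isClosed_biInter fun x _ => isClosed_le (by fun_prop) continuous_const

lemma sum_discMeasure_turnedNormalCone_le {T : Set (Euc 2)} {s : Finset (Euc 2)}
    (hs : (s : Set (Euc 2)) ⊆ T) :
    ∑ v ∈ s, discMeasure.real (turnedNormalCone T v) ≤ 1 := by
  have hpair : (s : Set (Euc 2)).Pairwise
      (Function.onFun (AEDisjoint discMeasure) (turnedNormalCone T)) := by
    intro v hv w hw hvw
    refine discMeasure_null
      (measure_mono_null ?_ (volume_cross_eq_zero (sub_ne_zero.2 hvw.symm)))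
    rintro y ⟨hyv, hyw⟩
    have h1 := hyv w (hs hw)
    have h2 := hyw v (hs hv)
    rw [← neg_sub, cross_neg_right, neg_nonpos] at h2
    exact le_antisymm h1 h2
  have h := measure_biUnion_finset₀ hpair
    fun v _ => (isClosed_turnedNormalCone T v).measurableSet.nullMeasurableSet
  calc ∑ v ∈ s, discMeasure.real (turnedNormalCone T v)
      = discMeasure.real (⋃ v ∈ s, turnedNormalCone T v) := by
        rw [measureReal_def, h, ENNReal.toReal_sum fun _ _ => measure_ne_top _ _]
        rfl
    _ ≤ 1 := measureReal_le_one

lemma le_sum_turnAngle {T : Set (Euc 2)} (hT : Convex ℝ T) (hi : (interior T).Nonempty)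
    {s : Finset (Euc 2)} (hs : (s : Set (Euc 2)) ⊆ T.extremePoints ℝ) :
    (s.card : ℝ) / 2 - 1 ≤ ∑ v ∈ s, turnAngle T v := by
  have h1 : ∑ v ∈ s, (1 / 2 : ℝ) ≤
      ∑ v ∈ s, (turnAngle T v + discMeasure.real (turnedNormalCone T v)) :=
    Finset.sum_le_sum fun v hv =>
      half_le_turnAngle_add hT hi (hs hv).1 (extremePoints_notMem_interior (hs hv))
  rw [Finset.sum_add_distrib, Finset.sum_const, nsmul_eq_mul] at h1
  have h2 := sum_discMeasure_turnedNormalCone_le (hs.trans extremePoints_subset)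
  linarith

section Tilings

variable {𝒯 : Set (Set (Euc 2))}

lemma eventually_mem_tile (h𝒯 : IsTiling 𝒯) (hlf : LocallyFiniteTiling 𝒯) (v : Euc 2) :
    ∀ᶠ p in 𝓝 v, ∀ T ∈ 𝒯, p ∈ T → v ∈ T := by
  have hfin := hlf _ (isCompact_closedBall v 1)
  have h1 : ∀ᶠ p in 𝓝 v, ∀ T ∈ {T ∈ 𝒯 | (T ∩ Metric.closedBall v 1).Nonempty}, p ∈ T → v ∈ T := by
    rw [Filter.eventually_all_finite hfin]
    intro T hT
    by_cases hvT : v ∈ T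
    · exact Filter.Eventually.of_forall fun _ _ => hvT
    · filter_upwards [(h𝒯.1 T hT.1).isOpen_compl.mem_nhds hvT] with p hp hpT
      exact absurd hpT hp
  filter_upwards [h1, Metric.closedBall_mem_nhds v one_pos] with p hp hpv T hT hpT
  exact hp T ⟨hT, p, hpT, hpv⟩ hpT

lemma exists_mem_closure_inwardCone (h𝒯 : IsTiling 𝒯) (hlf : LocallyFiniteTiling 𝒯)
    (hconv : ∀ T ∈ 𝒯, Convex ℝ T) (hinter : ∀ T ∈ 𝒯, (interior T).Nonempty) (v x : Euc 2) :
    ∃ T ∈ 𝒯, v ∈ T ∧ x ∈ closure (inwardCone T v) := by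
  have hlim : Filter.Tendsto (fun t : ℝ => v + t • x) (𝓝[>] 0) (𝓝 v) := by
    have : Continuous fun t : ℝ => v + t • x := by fun_prop
    simpa using (this.tendsto 0).mono_left nhdsWithin_le_nhds
  obtain ⟨t, hv, ht⟩ :=
    ((hlim.eventually (eventually_mem_tile h𝒯 hlf v)).and self_mem_nhdsWithin).exists
  replace ht : 0 < t := ht
  obtain ⟨T, hT, hp⟩ : v + t • x ∈ ⋃₀ 𝒯 := by rw [h𝒯.2.1]; trivial
  refine ⟨T, hT, hv T hT hp, ?_⟩
  have hcl : v + t • x ∈ closure (interior T) := by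
    rw [(hconv T hT).closure_interior_eq_closure_of_nonempty_interior (hinter T hT)]
    exact subset_closure hp
  have := map_mem_closure (f := fun p : Euc 2 => t⁻¹ • (p - v)) (t := inwardCone T v)
    (by fun_prop) hcl fun p hp => smul_mem_inwardCone (sub_mem_inwardCone hp) (by positivity)
  simpa [smul_smul, ht.ne'] using this

lemma disjoint_inwardCone (h𝒯 : IsTiling 𝒯) (hconv : ∀ T ∈ 𝒯, Convex ℝ T) {v : Euc 2}
    {S T : Set (Euc 2)} (hS : S ∈ 𝒯) (hT : T ∈ 𝒯) (hvS : v ∈ S) (hvT : v ∈ T) (hST : S ≠ T) :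
    Disjoint (inwardCone S v) (inwardCone T v) := by
  rw [Set.disjoint_left]
  rintro x ⟨s, hs, hxS⟩ ⟨t, ht, hxT⟩
  have hr : 0 < min s t := lt_min hs ht
  have : v + min s t • x ∈ interior S ∩ interior T :=
    ⟨add_smul_mem_interior_of_le (hconv S hS) hvS hr (min_le_left _ _) hxS,
      add_smul_mem_interior_of_le (hconv T hT) hvT hr (min_le_right _ _) hxT⟩
  rw [h𝒯.2.2 hS hT hST] at this
  exact this

lemma sum_turnAngle_eq_one (h𝒯 : IsTiling 𝒯) (hlf : LocallyFiniteTiling 𝒯)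
    (hconv : ∀ T ∈ 𝒯, Convex ℝ T) (hinter : ∀ T ∈ 𝒯, (interior T).Nonempty) {v : Euc 2}
    {F : Finset (Set (Euc 2))} (hF : ∀ T, T ∈ F ↔ T ∈ 𝒯 ∧ v ∈ T) :
    ∑ T ∈ F, turnAngle T v = 1 := by
  apply le_antisymm
  · have h := measureReal_biUnion_finset (μ := discMeasure) (s := F)
      (f := fun T => inwardCone T v)
      (fun S hS T hT hST => disjoint_inwardCone h𝒯 hconv ((hF S).1 hS).1 ((hF T).1 hT).1
        ((hF S).1 hS).2 ((hF T).1 hT).2 hST)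
      fun _ _ => isOpen_inwardCone.measurableSet
    exact h.symm.trans_le measureReal_le_one
  · have hcl : ∀ T ∈ F, discMeasure.real (closure (inwardCone T v)) ≤ turnAngle T v := by
      intro T hT
      have hc := convex_inwardCone (hconv T ((hF T).1 hT).1) ((hF T).1 hT).2
      have h0 : discMeasure.real (frontier (inwardCone T v)) = 0 :=
        (measureReal_eq_zero_iff).2 (discMeasure_null (hc.addHaar_frontier volume))
      have h1 := measureReal_union_le (μ := discMeasure)
        (inwardCone T v) (frontier (inwardCone T v))
      rw [← closure_eq_self_union_frontier, h0, add_zero] at h1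
      exact h1
    calc (1 : ℝ) = discMeasure.real univ := probReal_univ.symm
      _ ≤ discMeasure.real (⋃ T ∈ F, closure (inwardCone T v)) := by
        refine measureReal_mono (fun x _ => ?_) (measure_ne_top _ _)
        obtain ⟨T, hT, hvT, hx⟩ := exists_mem_closure_inwardCone h𝒯 hlf hconv hinter v x
        exact mem_biUnion (x := T) ((hF T).2 ⟨hT, hvT⟩) hx
      _ ≤ ∑ T ∈ F, discMeasure.real (closure (inwardCone T v)) := measureReal_biUnion_finset_le _ _
      _ ≤ _ := Finset.sum_le_sum hcl

/-- The tile corners meeting at a point have average angle at most a third of a full turn. -/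
lemma sum_turnAngle_le_card_div_three (h𝒯 : IsTiling 𝒯) (hlf : LocallyFiniteTiling 𝒯)
    (hpoly : ∀ T ∈ 𝒯, IsConvexPolytope T) {v : Euc 2} {K : Finset (Set (Euc 2))}
    (hK : ∀ T, T ∈ K ↔ T ∈ 𝒯 ∧ v ∈ T.extremePoints ℝ) :
    ∑ T ∈ K, turnAngle T v ≤ (K.card : ℝ) / 3 := by
  classical
  rcases K.eq_empty_or_nonempty with rfl | ⟨T₀, hT₀⟩
  · simp
  have hconv : ∀ T ∈ 𝒯, Convex ℝ T := by
    intro T hT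
    obtain ⟨⟨V, rfl⟩, -⟩ := hpoly T hT
    exact convex_convexHull ℝ _
  have hinter : ∀ T ∈ 𝒯, (interior T).Nonempty := fun T hT => (hpoly T hT).2
  have hfin : {T ∈ 𝒯 | v ∈ T}.Finite := by
    refine (hlf _ (isCompact_singleton (x := v))).subset ?_
    rintro T ⟨hT, hv⟩
    exact ⟨hT, v, hv, rfl⟩
  set F := hfin.toFinset with hFdef
  have hF : ∀ T, T ∈ F ↔ T ∈ 𝒯 ∧ v ∈ T := by simp [hFdef]
  have hKF : K ⊆ F := fun T hT => (hF T).2 ⟨((hK T).1 hT).1, ((hK T).1 hT).2.1⟩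
  have hout : ∀ T ∈ F, v ∉ interior T := by
    intro T hT hv
    obtain ⟨hT₀', hv₀⟩ := (hK T₀).1 hT₀
    rcases eq_or_ne T T₀ with rfl | hne
    · exact extremePoints_notMem_interior hv₀ hv
    · have hcl : v ∈ closure (interior T₀) := by
        rw [(hconv _ hT₀').closure_interior_eq_closure_of_nonempty_interior (hinter _ hT₀')]
        exact subset_closure hv₀.1
      have h := mem_closure_iff.1 hcl _ isOpen_interior hv
      rw [h𝒯.2.2 ((hF T).1 hT).1 hT₀' hne] at h
      exact h.ne_empty rfl
  have hlt : ∀ T ∈ K, turnAngle T v < 1 / 2 := by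
    intro T hT
    obtain ⟨hT', hv⟩ := (hK T).1 hT
    obtain ⟨⟨V, rfl⟩, -⟩ := hpoly T hT'
    exact turnAngle_lt_half hv
  have hltsum : ∑ T ∈ K, turnAngle T v < K.card / 2 := by
    have := Finset.sum_lt_sum_of_nonempty ⟨T₀, hT₀⟩ hlt
    rw [Finset.sum_const, nsmul_eq_mul] at this
    linarith
  have hhalf : ∑ T ∈ F \ K, turnAngle T v = (F \ K).card / 2 := by
    have : ∀ T ∈ F \ K, turnAngle T v = 1 / 2 := by
      intro T hT
      rw [Finset.mem_sdiff] at hT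
      obtain ⟨hT', hv⟩ := (hF T).1 hT.1
      exact le_antisymm (turnAngle_le_half (hconv T hT') hv (hout T hT.1))
        (half_le_turnAngle_of_notMem_extremePoints (hconv T hT') (hinter T hT') hv (hout T hT.1)
          fun h => hT.2 ((hK T).2 ⟨hT', h⟩))
    rw [Finset.sum_congr rfl this, Finset.sum_const, nsmul_eq_mul]
    ring
  have hsum : ∑ T ∈ F \ K, turnAngle T v + ∑ T ∈ K, turnAngle T v = 1 := by
    rw [Finset.sum_sdiff hKF, sum_turnAngle_eq_one h𝒯 hlf hconv hinter hF]
  generalize (F \ K).card = l at hhalf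
  generalize K.card = k at hltsum ⊢
  have hk : 2 < k + l := by
    have : (2 : ℝ) < k + l := by linarith
    exact_mod_cast this
  have hk' : (3 : ℝ) ≤ k + l := by exact_mod_cast hk
  have hl' : (0 : ℝ) ≤ l := by positivity
  linarith

end Tilings

section Copies

variable (g : Euc 2 ≃ᵢ Euc 2)

lemma IsConvexPolytope.image_isometry {P : Set (Euc 2)} (hP : IsConvexPolytope P) :
    IsConvexPolytope (g '' P) := by
  classical
  obtain ⟨⟨V, rfl⟩, hi⟩ := hP
  refine ⟨⟨V.image g, ?_⟩, ?_⟩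
  · rw [Finset.coe_image]
    exact g.toRealAffineIsometryEquiv.toAffineEquiv.toAffineMap.image_convexHull V
  · exact (hi.image g).mono (g.toHomeomorph.image_interior _).subset

lemma extremePoints_image_isometry (P : Set (Euc 2)) :
    (g '' P).extremePoints ℝ = g '' P.extremePoints ℝ := by
  have hseg : ∀ a b : Euc 2, g '' openSegment ℝ a b = openSegment ℝ (g a) (g b) :=
    image_openSegment ℝ g.toRealAffineIsometryEquiv.toAffineEquiv.toAffineMap
  ext y
  obtain ⟨x, rfl⟩ := g.surjective y
  simp only [mem_extremePoints_iff_left, g.injective.mem_set_image, forall_mem_image, ← hseg,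
    g.injective.eq_iff]

lemma volume_interior_image_isometry (P : Set (Euc 2)) :
    volume (interior (g '' P)) = volume (interior P) := by
  have h : interior (g '' P) = g '' interior P := (g.toHomeomorph.image_interior P).symm
  rw [h, ← EuclideanSpace.euclideanHausdorffMeasure_eq_volume,
    g.isometry.euclideanHausdorffMeasure_image]

end Copies

/-- Contradictory growth: at least exponential and at most quadratic. -/
lemma false_of_pow_le_sq {a q C : ℝ} (ha : 0 < a) (hq : 1 < q)
    (h : ∀ k : ℕ, q ^ k * a ≤ ((k : ℝ) + 1) ^ 2 * C) : False := by
  have hq0 : 0 < q := one_pos.trans hq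
  have hlim := (tendsto_pow_const_mul_const_pow_of_abs_lt_one 2 (r := q⁻¹) (by
    rw [abs_of_pos (by positivity)]; exact inv_lt_one_of_one_lt₀ hq)).comp
      (Filter.tendsto_add_atTop_nat 1)
  have hlim' := (hlim.mul_const C)
  rw [zero_mul] at hlim'
  have hle : a * q⁻¹ ≤ 0 := by
    refine ge_of_tendsto' hlim' fun k => ?_
    have := mul_le_mul_of_nonneg_right (h k) (by positivity : 0 ≤ q⁻¹ ^ (k + 1))
    have h2 : q ^ k * a * q⁻¹ ^ (k + 1) = a * q⁻¹ := by
      rw [pow_succ, inv_pow]; field_simp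
    rw [h2] at this
    simp only [Function.comp, Nat.cast_add, Nat.cast_one]
    linarith
  have : 0 < a * q⁻¹ := by positivity
  linarith

section Counting

variable {𝒯 : Set (Set (Euc 2))}

lemma card_mul_volume_le (h𝒯 : IsTiling 𝒯) {a D R : ℝ}
    (hvol : ∀ T ∈ 𝒯, volume.real (interior T) = a)
    (hdiam : ∀ T ∈ 𝒯, ∀ x ∈ T, ∀ y ∈ T, dist x y ≤ D) (hDR : 0 ≤ R + D)
    {F : Finset (Set (Euc 2))}
    (hF : ∀ T ∈ F, T ∈ 𝒯 ∧ (T ∩ Metric.closedBall 0 R).Nonempty) :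
    F.card * a ≤ (R + D) ^ 2 * volume.real (Metric.ball (0 : Euc 2) 1) := by
  have hsub : ∀ T ∈ F, interior T ⊆ Metric.closedBall 0 (R + D) := by
    intro T hT x hx
    obtain ⟨hT', y, hyT, hy⟩ := hF T hT
    rw [Metric.mem_closedBall] at hy ⊢
    linarith [dist_triangle x y 0, hdiam T hT' x (interior_subset hx) y hyT]
  have hne : ∀ T ∈ F, volume (interior T) ≠ ⊤ := fun T hT =>
    ((measure_mono (hsub T hT)).trans_lt measure_closedBall_lt_top).ne
  have h1 := measureReal_biUnion_finset (μ := volume) (s := F) (f := interior)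
    (fun S hS T hT hST => Set.disjoint_iff_inter_eq_empty.2
      (h𝒯.2.2 (hF S hS).1 (hF T hT).1 hST)) (fun _ _ => isOpen_interior.measurableSet) hne
  rw [Finset.sum_congr rfl fun T hT => hvol T (hF T hT).1, Finset.sum_const, nsmul_eq_mul] at h1
  rw [← h1]
  have h2 : volume.real (Metric.closedBall (0 : Euc 2) (R + D)) =
      (R + D) ^ 2 * volume.real (Metric.ball (0 : Euc 2) 1) := by
    rw [measureReal_def, Measure.addHaar_closedBall volume _ hDR, ENNReal.toReal_mul,
      ENNReal.toReal_ofReal (by positivity), finrank_euclideanSpace_fin]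
    rfl
  rw [← h2]
  exact measureReal_mono (iUnion₂_subset hsub) measure_closedBall_lt_top.ne

/-- If the tiles have at least seven corners, then a definite proportion of the tiles meeting a
disc sticks out of it. -/
lemma card_mul_le_card_mul (h𝒯 : IsTiling 𝒯) (hlf : LocallyFiniteTiling 𝒯)
    (hpoly : ∀ T ∈ 𝒯, IsConvexPolytope T) {n : ℕ} (hn : 7 ≤ n)
    (hext : ∀ T ∈ 𝒯, (T.extremePoints ℝ).Finite ∧ (T.extremePoints ℝ).ncard = n) {R : ℝ}
    {F I : Finset (Set (Euc 2))}
    (hF : ∀ T, T ∈ F ↔ T ∈ 𝒯 ∧ (T ∩ Metric.closedBall 0 R).Nonempty) (hIF : I ⊆ F)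
    (hI : ∀ T ∈ I, T ⊆ Metric.closedBall 0 R) :
    (I.card : ℝ) * (2 * n + 1) ≤ F.card * (2 * n) := by
  classical
  have hmem : ∀ T ∈ F, T ∈ 𝒯 := fun T hT => ((hF T).1 hT).1
  have hfin : ∀ T : Set (Euc 2), ∃ e : Finset (Euc 2), T ∈ F →
      (e : Set (Euc 2)) = T.extremePoints ℝ ∧ e.card = n := by
    intro T
    by_cases hT : T ∈ F
    · obtain ⟨h1, h2⟩ := hext T (hmem T hT)
      exact ⟨h1.toFinset, fun _ => ⟨h1.coe_toFinset, by rw [← h2, ncard_eq_toFinset_card _ h1]⟩⟩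
    · exact ⟨∅, fun h => absurd h hT⟩
  choose e he using hfin
  have hmem_e : ∀ T ∈ F, ∀ v, v ∈ e T ↔ v ∈ T.extremePoints ℝ := by
    intro T hT v
    rw [← (he T hT).1, Finset.mem_coe]
  set c : Set (Euc 2) → Finset (Euc 2) := fun T =>
    (e T).filter (· ∈ Metric.closedBall 0 R) with hc
  have hcn : ∀ T ∈ F, (c T).card ≤ n := fun T hT =>
    (Finset.card_filter_le _ _).trans (he T hT).2.le
  set W := F.biUnion c
  have hswap : ∑ T ∈ F, ∑ v ∈ c T, (turnAngle T v - 1 / 3) =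
      ∑ v ∈ W, ∑ T ∈ F.filter (v ∈ c ·), (turnAngle T v - 1 / 3) := by
    refine Finset.sum_comm' fun T v => ?_
    simp only [W, Finset.mem_biUnion, Finset.mem_filter]
    constructor
    · rintro ⟨h1, h2⟩
      exact ⟨⟨h1, h2⟩, T, h1, h2⟩
    · rintro ⟨h, -⟩
      exact h
  have hupper : ∑ T ∈ F, ∑ v ∈ c T, (turnAngle T v - 1 / 3) ≤ 0 := by
    rw [hswap]
    refine Finset.sum_nonpos fun v hv => ?_
    obtain ⟨T₀, -, hvT₀⟩ := Finset.mem_biUnion.1 hv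
    have hvR : v ∈ Metric.closedBall 0 R := (Finset.mem_filter.1 hvT₀).2
    have hK : ∀ T, T ∈ F.filter (v ∈ c ·) ↔ T ∈ 𝒯 ∧ v ∈ T.extremePoints ℝ := by
      intro T
      rw [Finset.mem_filter]
      constructor
      · rintro ⟨hT, hvT⟩
        exact ⟨hmem T hT, (hmem_e T hT v).1 (Finset.mem_filter.1 hvT).1⟩
      · rintro ⟨hT, hvT⟩
        have hTF : T ∈ F := (hF T).2 ⟨hT, v, hvT.1, hvR⟩
        exact ⟨hTF, Finset.mem_filter.2 ⟨(hmem_e T hTF v).2 hvT, hvR⟩⟩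
    have := sum_turnAngle_le_card_div_three h𝒯 hlf hpoly hK
    rw [Finset.sum_sub_distrib, Finset.sum_const, nsmul_eq_mul]
    linarith
  have hn' : (7 : ℝ) ≤ n := by exact_mod_cast hn
  have hin : ∀ T ∈ I, (1 / 6 : ℝ) ≤ ∑ v ∈ c T, (turnAngle T v - 1 / 3) := by
    intro T hT
    have hTF := hIF hT
    have hcT : c T = e T := Finset.filter_true_of_mem fun v hv =>
      hI T hT ((hmem_e T hTF v).1 hv).1
    obtain ⟨⟨V, hV⟩, hi⟩ := hpoly T (hmem T hTF)
    have := le_sum_turnAngle (T := T) (hV ▸ convex_convexHull ℝ _) hi (he T hTF).1.le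
    rw [hcT, Finset.sum_sub_distrib, Finset.sum_const, nsmul_eq_mul]
    rw [(he T hTF).2] at this ⊢
    linarith
  have hout : ∀ T ∈ F \ I, -(n / 3 : ℝ) ≤ ∑ v ∈ c T, (turnAngle T v - 1 / 3) := by
    intro T hT
    have h1 : ((c T).card : ℝ) ≤ n := by exact_mod_cast hcn T (Finset.mem_sdiff.1 hT).1
    have h2 : 0 ≤ ∑ v ∈ c T, turnAngle T v := Finset.sum_nonneg fun _ _ => measureReal_nonneg
    rw [Finset.sum_sub_distrib, Finset.sum_const, nsmul_eq_mul]
    linarith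
  have h1 := Finset.sum_le_sum hin
  have h2 := Finset.sum_le_sum hout
  rw [Finset.sum_const, nsmul_eq_mul] at h1 h2
  rw [← Finset.sum_sdiff hIF] at hupper
  rw [Finset.cast_card_sdiff hIF] at h2
  nlinarith

end Counting

/-- a convex plane-filler has at most 6 extreme points. -/
theorem plane_filler_has_at_most_six_vertices (P : Set (Euc 2))
    (hP : IsConvexPolytope P)
    (h : ∃ 𝒯 : Set (Set (Euc 2)), IsTiling 𝒯 ∧ LocallyFiniteTiling 𝒯 ∧ Monohedral 𝒯 P) :
    (Set.extremePoints ℝ P).ncard ≤ 6 := by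
  obtain ⟨𝒯, h𝒯, hlf, hmono⟩ := h
  by_contra! hn
  have hpoly : ∀ T ∈ 𝒯, IsConvexPolytope T := by
    intro T hT
    obtain ⟨g, rfl⟩ := hmono T hT
    exact hP.image_isometry g
  have hext : ∀ T ∈ 𝒯, (T.extremePoints ℝ).Finite ∧
      (T.extremePoints ℝ).ncard = (P.extremePoints ℝ).ncard := by
    intro T hT
    obtain ⟨g, rfl⟩ := hmono T hT
    rw [extremePoints_image_isometry]
    exact ⟨(finite_of_ncard_pos (by omega)).image _, ncard_image_of_injective _ g.injective⟩
  have hvol : ∀ T ∈ 𝒯, volume.real (interior T) = volume.real (interior P) := by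
    intro T hT
    obtain ⟨g, rfl⟩ := hmono T hT
    rw [measureReal_def, measureReal_def, volume_interior_image_isometry]
  have hbdd : Bornology.IsBounded P := by
    obtain ⟨⟨V, rfl⟩, -⟩ := hP
    exact isBounded_convexHull.2 V.finite_toSet.isBounded
  have hvolpos : 0 < volume.real (interior P) :=
    ENNReal.toReal_pos (isOpen_interior.measure_pos volume hP.2).ne'
      (hbdd.subset interior_subset).measure_lt_top.ne
  obtain ⟨D, hD0, hD⟩ : ∃ D : ℝ, 0 ≤ D ∧ ∀ T ∈ 𝒯, ∀ x ∈ T, ∀ y ∈ T, dist x y ≤ D := by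
    refine ⟨Metric.diam P, Metric.diam_nonneg, fun T hT => ?_⟩
    obtain ⟨g, rfl⟩ := hmono T hT
    rintro _ ⟨x, hx, rfl⟩ _ ⟨y, hy, rfl⟩
    rw [g.dist_eq]
    exact Metric.dist_le_diam_of_mem hbdd hx hy
  set F : ℝ → Finset (Set (Euc 2)) := fun R =>
    (hlf (Metric.closedBall 0 R) (isCompact_closedBall 0 R)).toFinset with hFdef
  have hF : ∀ R T, T ∈ F R ↔ T ∈ 𝒯 ∧ (T ∩ Metric.closedBall 0 R).Nonempty := by
    simp [hFdef]
  set n := (P.extremePoints ℝ).ncard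
  have hn0 : (0 : ℝ) < n := by exact_mod_cast (by omega : 0 < n)
  have hstep : ∀ R, ((F R).card : ℝ) * (2 * n + 1) ≤ (F (R + D)).card * (2 * n) := by
    intro R
    refine card_mul_le_card_mul h𝒯 hlf hpoly hn hext (hF (R + D)) ?_ ?_
    · intro T hT
      obtain ⟨hT', y, hyT, hy⟩ := (hF R T).1 hT
      exact (hF _ T).2 ⟨hT', y, hyT, Metric.closedBall_subset_closedBall (by linarith) hy⟩
    · intro T hT x hx
      obtain ⟨hT', y, hyT, hy⟩ := (hF R T).1 hT
      rw [Metric.mem_closedBall] at hy ⊢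
      linarith [dist_triangle x y 0, hD T hT' x hx y hyT]
  set q : ℝ := (2 * n + 1) / (2 * n)
  have hq : 1 < q := by
    rw [one_lt_div (by positivity)]
    linarith
  have hgrow : ∀ k : ℕ, q ^ k ≤ (F (k * D)).card := by
    intro k
    induction k with
    | zero =>
      obtain ⟨T, hT, h0⟩ : (0 : Euc 2) ∈ ⋃₀ 𝒯 := by rw [h𝒯.2.1]; trivial
      have : 0 < (F ((0 : ℕ) * D)).card :=
        Finset.card_pos.2 ⟨T, (hF _ T).2 ⟨hT, 0, h0, by simp⟩⟩
      rw [pow_zero]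
      exact_mod_cast this
    | succ k ih =>
      have h1 := hstep (k * D)
      have h2 : (k : ℝ) * D + D = (k + 1 : ℕ) * D := by push_cast; ring
      rw [h2] at h1
      rw [pow_succ]
      refine (mul_le_mul_of_nonneg_right ih (by positivity)).trans ?_
      rwa [mul_div_assoc', div_le_iff₀ (by positivity)]
  refine false_of_pow_le_sq hvolpos hq
    (C := D ^ 2 * volume.real (Metric.ball (0 : Euc 2) 1)) fun k => ?_
  calc q ^ k * volume.real (interior P) ≤ (F (k * D)).card * volume.real (interior P) := by
        gcongr
        exact hgrow k
    _ ≤ (k * D + D) ^ 2 * volume.real (Metric.ball (0 : Euc 2) 1) :=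
        card_mul_volume_le h𝒯 hvol hD (by positivity) fun T hT => (hF _ T).1 hT
    _ = _ := by ring
end
end

section
/- For every integer p ≥ 3, there exists a locally finite face-to-face tiling of ℝ² by convex polygons each of which has exactly p extreme points; that is, the Euclidean plane admits a monotypic face-to-face tiling by convex p-gons for every p ≥ 3. -/
open Set

noncomputable section

lemma isExtreme_inter_of_forall_mem {d : ℕ} {S T : Set (Euc d)}
    (h : ∀ u ∈ S, ∀ v ∈ S, ∀ α β : ℝ, 0 < α → 0 < β → α + β = 1 →
      α • u + β • v ∈ S → α • u + β • v ∈ T → u ∈ T) : IsExtreme ℝ S (S ∩ T) := by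
  refine ⟨inter_subset_left, ?_⟩
  rintro u hu v hv _ ⟨hxS, hxT⟩ ⟨α, β, hα, hβ, hαβ, rfl⟩
  exact ⟨hu, h u hu v hv α β hα hβ hαβ hxS hxT⟩

/-- If `S ∩ T` is a face of `S` containing an interior point of `S`, then `S ⊆ T`. -/
lemma subset_of_isExtreme_inter {d : ℕ} {S T : Set (Euc d)} (h : IsExtreme ℝ S (S ∩ T))
    {x : Euc d} (hxS : x ∈ interior S) (hxT : x ∈ T) : S ⊆ T := by
  intro u hu
  have hcont : Filter.Tendsto (fun ε : ℝ => x + ε • (x - u)) (nhdsWithin 0 (Ioi 0)) (nhds x) := by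
    have : Continuous fun ε : ℝ => x + ε • (x - u) := by fun_prop
    simpa using (this.tendsto 0).mono_left nhdsWithin_le_nhds
  obtain ⟨ε, hεS, hε⟩ := ((hcont.eventually (mem_interior_iff_mem_nhds.mp hxS)).and
    self_mem_nhdsWithin).exists
  have hε' : 0 < ε := hε
  refine (h.2 hu hεS ⟨interior_subset hxS, hxT⟩
    ⟨ε / (1 + ε), 1 / (1 + ε), by positivity, by positivity, by field_simp; ring, ?_⟩).2
  ext i
  simp
  field_simp
  ring

lemma FaceToFace.pairwise_interior {d : ℕ} {𝒯 : Set (Set (Euc d))} (h : FaceToFace 𝒯) :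
    𝒯.Pairwise fun S T => interior S ∩ interior T = ∅ := by
  intro S hS T hT hne
  by_contra hint
  obtain ⟨x, hxS, hxT⟩ := nonempty_iff_ne_empty.mpr hint
  obtain ⟨h₁, h₂⟩ := h S hS T hT hne
  rw [inter_comm] at h₂
  exact hne ((subset_of_isExtreme_inter h₁ hxS (interior_subset hxT)).antisymm
    (subset_of_isExtreme_inter h₂ hxT (interior_subset hxS)))

lemma eq_convexHull_and_extremePoints_eq {d : ℕ} {T : Set (Euc d)} {V : Finset (Euc d)}
    (hT : Convex ℝ T) (hsub : T ⊆ convexHull ℝ (V : Set (Euc d)))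
    (hV : ∀ v ∈ V, v ∈ Set.extremePoints ℝ T) :
    T = convexHull ℝ (V : Set (Euc d)) ∧ Set.extremePoints ℝ T = V := by
  have hVT : (V : Set (Euc d)) ⊆ T := fun v hv => extremePoints_subset (hV v hv)
  have hEq : T = convexHull ℝ (V : Set (Euc d)) := hsub.antisymm (convexHull_min hVT hT)
  refine ⟨hEq, Subset.antisymm ?_ hV⟩
  rw [hEq]
  exact extremePoints_convexHull_subset

lemma IsConvexPolytope.isClosed {d : ℕ} {P : Set (Euc d)} (hP : IsConvexPolytope P) :
    IsClosed P := by
  obtain ⟨⟨V, rfl⟩, -⟩ := hP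
  exact V.finite_toSet.isClosed_convexHull ℝ

lemma left_eq_of_le_convexCombo {α β u v c : ℝ} (hα : 0 < α) (hβ : 0 < β) (hαβ : α + β = 1)
    (hu : u ≤ c) (hv : v ≤ c) (h : c ≤ α * u + β * v) : u = c := by
  have hc : c = α * c + β * c := by rw [← add_mul, hαβ, one_mul]
  nlinarith [mul_le_mul_of_nonneg_left hv hβ.le]

lemma left_eq_of_convexCombo_le {α β u v c : ℝ} (hα : 0 < α) (hβ : 0 < β) (hαβ : α + β = 1)
    (hu : c ≤ u) (hv : c ≤ v) (h : α * u + β * v ≤ c) : u = c := by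
  have := left_eq_of_le_convexCombo hα hβ hαβ (neg_le_neg hu) (neg_le_neg hv) (by linarith)
  linarith

lemma left_mem_of_convexCombo_mem {h : ℝ} (hh : 0 < h) {a b c : ℤ} {α β u v : ℝ}
    (hα : 0 < α) (hβ : 0 < β) (hαβ : α + β = 1)
    (hu : u ∈ Icc (a * h) ((a + 1) * h)) (hv : v ∈ Icc (a * h) ((a + 1) * h))
    (hw : α * u + β * v ∈ Icc (b * h) (c * h)) : u ∈ Icc (b * h) (c * h) := by
  constructor
  · rcases le_or_gt b a with hba | hba
    · have : (b : ℝ) ≤ a := by exact_mod_cast hba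
      exact (mul_le_mul_of_nonneg_right this hh.le).trans hu.1
    · have : (a : ℝ) + 1 ≤ b := by exact_mod_cast hba
      have := mul_le_mul_of_nonneg_right this hh.le
      exact (left_eq_of_le_convexCombo hα hβ hαβ (hu.2.trans this) (hv.2.trans this) hw.1).ge
  · rcases lt_or_ge a c with hac | hac
    · have : (a : ℝ) + 1 ≤ c := by exact_mod_cast hac
      exact hu.2.trans (mul_le_mul_of_nonneg_right this hh.le)
    · have : (c : ℝ) ≤ a := by exact_mod_cast hac
      have := mul_le_mul_of_nonneg_right this hh.le
      exact (left_eq_of_convexCombo_le hα hβ hαβ (this.trans hu.1) (this.trans hv.1) hw.2).le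

lemma mem_extremePoints_of_forall_eq {d : ℕ} {T : Set (Euc d)} {x : Euc d} (hx : x ∈ T)
    (h : ∀ u ∈ T, ∀ v ∈ T, ∀ α β : ℝ, 0 < α → 0 < β → α + β = 1 → α • u + β • v = x → u = x) :
    x ∈ Set.extremePoints ℝ T := by
  refine ⟨hx, ?_⟩
  rintro u hu v hv ⟨α, β, hα, hβ, hαβ, hw⟩
  exact h u hu v hv α β hα hβ hαβ hw

lemma euc_two_ext {u v : Euc 2} (h₀ : u 0 = v 0) (h₁ : u 1 = v 1) : u = v := by
  ext i
  fin_cases i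
  exacts [h₀, h₁]

/-- The integers `a` for which `[a h, (a + 1) h]` meets `[-M, M]` are bounded. -/
lemma finite_setOf_strip_meets {h : ℝ} (hh : 0 < h) (M : ℝ) :
    {a : ℤ | ∃ x ∈ Icc (a * h) ((a + 1) * h), |x| ≤ M}.Finite := by
  refine (Set.finite_Icc ⌊-(M / h) - 1⌋ ⌈M / h⌉).subset ?_
  rintro a ⟨x, ⟨hx₁, hx₂⟩, hx⟩
  obtain ⟨hM₁, hM₂⟩ := abs_le.mp hx
  constructor
  · have : -(M / h) - 1 ≤ a := by
      have : -(a + 1) ≤ M / h := by rw [le_div_iff₀ hh]; linarith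
      linarith
    exact_mod_cast (Int.floor_le _).trans this
  · have : (a : ℝ) ≤ M / h := by rw [le_div_iff₀ hh]; linarith
    exact_mod_cast this.trans (Int.le_ceil _)

lemma exists_forall_abs_coord_le {K : Set (Euc 2)} (hK : IsCompact K) :
    ∃ M : ℝ, ∀ x ∈ K, |x 0| ≤ M ∧ |x 1| ≤ M := by
  obtain ⟨M, hM⟩ := hK.isBounded.exists_norm_le
  exact ⟨M, fun x hx => ⟨(PiLp.norm_apply_le x 0).trans (hM x hx),
    (PiLp.norm_apply_le x 1).trans (hM x hx)⟩⟩

lemma mem_Icc_floor_div_mul {h : ℝ} (hh : 0 < h) (x : ℝ) :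
    x ∈ Icc ((⌊x / h⌋ : ℤ) * h) (((⌊x / h⌋ : ℤ) + 1) * h) :=
  ⟨(le_div_iff₀ hh).mp (Int.floor_le _), ((div_lt_iff₀ hh).mp (Int.lt_floor_add_one _)).le⟩

/-! ### Triangles -/

/-- The cell of the arrangement of the lines `x = i`, `y = j`, `x + y = k` with the given floors. -/
def triangleTile (i j k : ℤ) : Set (Euc 2) :=
  {p | p 0 ∈ Icc (i * (1 : ℝ)) ((i + 1) * 1) ∧ p 1 ∈ Icc (j * (1 : ℝ)) ((j + 1) * 1) ∧
    p 0 + p 1 ∈ Icc (k * (1 : ℝ)) ((k + 1) * 1)}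

lemma isExtreme_triangleTile_inter (i j k i' j' k' : ℤ) :
    IsExtreme ℝ (triangleTile i j k) (triangleTile i j k ∩ triangleTile i' j' k') := by
  refine isExtreme_inter_of_forall_mem ?_
  rintro u ⟨hu₀, hu₁, hu₂⟩ v ⟨hv₀, hv₁, hv₂⟩ α β hα hβ hαβ - ⟨hw₀, hw₁, hw₂⟩
  simp only [PiLp.add_apply, PiLp.smul_apply, smul_eq_mul] at hw₀ hw₁ hw₂
  have cast_succ (m : ℤ) : ((m + 1 : ℤ) : ℝ) = m + 1 := by push_cast; ring
  simp only [triangleTile, ← cast_succ] at hw₀ hw₁ hw₂ ⊢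
  refine ⟨left_mem_of_convexCombo_mem one_pos hα hβ hαβ hu₀ hv₀ hw₀,
    left_mem_of_convexCombo_mem one_pos hα hβ hαβ hu₁ hv₁ hw₁,
    left_mem_of_convexCombo_mem one_pos hα hβ hαβ hu₂ hv₂ ?_⟩
  convert hw₂ using 1
  ring

lemma convex_triangleTile (i j k : ℤ) : Convex ℝ (triangleTile i j k) := by
  rintro u ⟨hu₀, hu₁, hu₂⟩ v ⟨hv₀, hv₁, hv₂⟩ α β hα hβ hαβ
  refine ⟨convex_Icc _ _ hu₀ hv₀ hα hβ hαβ, convex_Icc _ _ hu₁ hv₁ hα hβ hαβ, ?_⟩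
  convert convex_Icc _ _ hu₂ hv₂ hα hβ hαβ using 1
  simp
  ring

lemma convexCombo_three_mem_convexHull {E : Type*} [AddCommGroup E] [Module ℝ E] {s : Set E}
    {a b c : E} (ha : a ∈ s) (hb : b ∈ s) (hc : c ∈ s) {r t w : ℝ} (hr : 0 ≤ r) (ht : 0 ≤ t)
    (hw : 0 ≤ w) (h : r + t + w = 1) : r • a + t • b + w • c ∈ convexHull ℝ s := by
  have := (convex_convexHull ℝ s).sum_mem (t := Finset.univ) (w := ![r, t, w]) (z := ![a, b, c])
    (by intro i _; fin_cases i <;> simpa) (by simpa [Fin.sum_univ_three] using h)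
    (by intro i _; fin_cases i <;> simp <;> apply subset_convexHull <;> assumption)
  simpa [Fin.sum_univ_three] using this

lemma triangleTile_lower (i j : ℤ) :
    IsConvexPolytope (triangleTile i j (i + j)) ∧
      (Set.extremePoints ℝ (triangleTile i j (i + j))).ncard = 3 := by
  classical
  set a : Euc 2 := !₂[(i : ℝ), j] with ha
  set b : Euc 2 := !₂[(i : ℝ) + 1, j] with hb
  set c : Euc 2 := !₂[(i : ℝ), j + 1] with hc
  obtain ⟨hhull, hext⟩ := eq_convexHull_and_extremePoints_eq (V := {a, b, c})
    (convex_triangleTile i j (i + j))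
    (by
      rintro x ⟨⟨h₁, h₂⟩, ⟨h₃, h₄⟩, h₅, h₆⟩
      push_cast at h₅ h₆
      have := convexCombo_three_mem_convexHull (s := ((({a, b, c} : Finset (Euc 2)) : Set (Euc 2))))
        (a := a) (b := b) (c := c) (by simp) (by simp) (by simp)
        (r := 1 - (x 0 - i) - (x 1 - j)) (t := x 0 - i) (w := x 1 - j)
        (by linarith) (by linarith) (by linarith) (by ring)
      convert this using 1
      apply euc_two_ext <;> simp [ha, hb, hc] <;> ring)
    (by
      intro v hv
      simp only [Finset.mem_insert, Finset.mem_singleton] at hv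
      refine mem_extremePoints_of_forall_eq ?_ ?_
      · rcases hv with rfl | rfl | rfl <;> simp [triangleTile, ha, hb, hc] <;> linarith
      rintro u ⟨hu₀, hu₁, hu₂⟩ w ⟨hw₀, hw₁, hw₂⟩ α β hα hβ hαβ h
      have h₀ : α * u 0 + β * w 0 = v 0 := by simp [← h]
      have h₁ : α * u 1 + β * w 1 = v 1 := by simp [← h]
      push_cast at hu₂ hw₂
      simp only [mul_one, mem_Icc] at *
      rcases hv with rfl | rfl | rfl <;> simp [ha, hb, hc] at h₀ h₁
      · exact euc_two_ext (left_eq_of_convexCombo_le hα hβ hαβ hu₀.1 hw₀.1 h₀.le)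
          (left_eq_of_convexCombo_le hα hβ hαβ hu₁.1 hw₁.1 h₁.le)
      · exact euc_two_ext (left_eq_of_le_convexCombo hα hβ hαβ hu₀.2 hw₀.2 h₀.ge)
          (left_eq_of_convexCombo_le hα hβ hαβ hu₁.1 hw₁.1 h₁.le)
      · exact euc_two_ext (left_eq_of_convexCombo_le hα hβ hαβ hu₀.1 hw₀.1 h₀.le)
          (left_eq_of_le_convexCombo hα hβ hαβ hu₁.2 hw₁.2 h₁.ge))
  refine ⟨⟨⟨_, hhull⟩, ?_⟩, ?_⟩
  · have h₀ : Continuous fun p : Euc 2 => p 0 := by fun_prop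
    have h₁ : Continuous fun p : Euc 2 => p 1 := by fun_prop
    refine ⟨!₂[(i : ℝ) + 1 / 4, j + 1 / 4], interior_maximal
      (t := {p : Euc 2 | (i : ℝ) < p 0} ∩ {p | (j : ℝ) < p 1} ∩ {p | p 0 + p 1 < i + j + 1}) ?_
      (((isOpen_lt continuous_const h₀).inter (isOpen_lt continuous_const h₁)).inter
        (isOpen_lt (h₀.add h₁) continuous_const)) ?_⟩
    · rintro p ⟨⟨h₁, h₂⟩, h₃⟩
      simp only [mem_ofPred_eq] at h₁ h₂ h₃
      refine ⟨⟨?_, ?_⟩, ⟨?_, ?_⟩, ?_, ?_⟩ <;> push_cast <;> linarith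
    · simp
      linarith
  · rw [hext, Set.ncard_coe_finset]
    refine Finset.card_eq_three.mpr ⟨a, b, c, fun h => ?_, fun h => ?_, fun h => ?_, rfl⟩
    · simpa [ha, hb] using congrArg (· 0) h
    · simpa [ha, hc] using congrArg (· 1) h
    · simpa [hb, hc] using congrArg (· 0) h

lemma triangleTile_upper (i j : ℤ) :
    IsConvexPolytope (triangleTile i j (i + j + 1)) ∧
      (Set.extremePoints ℝ (triangleTile i j (i + j + 1))).ncard = 3 := by
  classical
  set a : Euc 2 := !₂[(i : ℝ) + 1, j + 1] with ha
  set b : Euc 2 := !₂[(i : ℝ) + 1, j] with hb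
  set c : Euc 2 := !₂[(i : ℝ), j + 1] with hc
  obtain ⟨hhull, hext⟩ := eq_convexHull_and_extremePoints_eq (V := {a, b, c})
    (convex_triangleTile i j (i + j + 1))
    (by
      rintro x ⟨⟨h₁, h₂⟩, ⟨h₃, h₄⟩, h₅, h₆⟩
      push_cast at h₅ h₆
      have := convexCombo_three_mem_convexHull (s := ((({a, b, c} : Finset (Euc 2)) : Set (Euc 2))))
        (a := a) (b := b) (c := c) (by simp) (by simp) (by simp)
        (r := (x 0 - i) + (x 1 - j) - 1) (t := 1 - (x 1 - j)) (w := 1 - (x 0 - i))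
        (by linarith) (by linarith) (by linarith) (by ring)
      convert this using 1
      apply euc_two_ext <;> simp [ha, hb, hc] <;> ring)
    (by
      intro v hv
      simp only [Finset.mem_insert, Finset.mem_singleton] at hv
      refine mem_extremePoints_of_forall_eq ?_ ?_
      · rcases hv with rfl | rfl | rfl <;> simp [triangleTile, ha, hb, hc] <;>
          (try constructor) <;> linarith
      rintro u ⟨hu₀, hu₁, hu₂⟩ w ⟨hw₀, hw₁, hw₂⟩ α β hα hβ hαβ h
      have h₀ : α * u 0 + β * w 0 = v 0 := by simp [← h]
      have h₁ : α * u 1 + β * w 1 = v 1 := by simp [← h]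
      push_cast at hu₂ hw₂
      simp only [mul_one, mem_Icc] at *
      rcases hv with rfl | rfl | rfl <;> simp [ha, hb, hc] at h₀ h₁
      · exact euc_two_ext (left_eq_of_le_convexCombo hα hβ hαβ hu₀.2 hw₀.2 h₀.ge)
          (left_eq_of_le_convexCombo hα hβ hαβ hu₁.2 hw₁.2 h₁.ge)
      · exact euc_two_ext (left_eq_of_le_convexCombo hα hβ hαβ hu₀.2 hw₀.2 h₀.ge)
          (left_eq_of_convexCombo_le hα hβ hαβ hu₁.1 hw₁.1 h₁.le)
      · exact euc_two_ext (left_eq_of_convexCombo_le hα hβ hαβ hu₀.1 hw₀.1 h₀.le)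
          (left_eq_of_le_convexCombo hα hβ hαβ hu₁.2 hw₁.2 h₁.ge))
  refine ⟨⟨⟨_, hhull⟩, ?_⟩, ?_⟩
  · have h₀ : Continuous fun p : Euc 2 => p 0 := by fun_prop
    have h₁ : Continuous fun p : Euc 2 => p 1 := by fun_prop
    refine ⟨!₂[(i : ℝ) + 3 / 4, j + 3 / 4], interior_maximal
      (t := {p : Euc 2 | p 0 < (i : ℝ) + 1} ∩ {p | p 1 < (j : ℝ) + 1} ∩
        {p | (i : ℝ) + j + 1 < p 0 + p 1}) ?_
      (((isOpen_lt h₀ continuous_const).inter (isOpen_lt h₁ continuous_const)).inter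
        (isOpen_lt continuous_const (h₀.add h₁))) ?_⟩
    · rintro p ⟨⟨h₁, h₂⟩, h₃⟩
      simp only [mem_ofPred_eq] at h₁ h₂ h₃
      refine ⟨⟨?_, ?_⟩, ⟨?_, ?_⟩, ?_, ?_⟩ <;> push_cast <;> linarith
    · refine ⟨⟨?_, ?_⟩, ?_⟩ <;> norm_num
      linarith
  · rw [hext, Set.ncard_coe_finset]
    refine Finset.card_eq_three.mpr ⟨a, b, c, fun h => ?_, fun h => ?_, fun h => ?_, rfl⟩
    · simpa [ha, hb] using congrArg (· 1) h
    · simpa [ha, hc] using congrArg (· 0) h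
    · simpa [hb, hc] using congrArg (· 0) h

/-- The plane admits a face-to-face tiling by triangles. -/
lemma exists_triangle_tiling :
    ∃ 𝒯 : Set (Set (Euc 2)), IsTiling 𝒯 ∧ LocallyFiniteTiling 𝒯 ∧ FaceToFace 𝒯 ∧
      ∀ T ∈ 𝒯, IsConvexPolytope T ∧ (Set.extremePoints ℝ T).ncard = 3 := by
  set 𝒯 : Set (Set (Euc 2)) :=
    {T | ∃ i j k : ℤ, (k = i + j ∨ k = i + j + 1) ∧ T = triangleTile i j k} with h𝒯
  have hface : FaceToFace 𝒯 := by
    rintro _ ⟨i, j, k, -, rfl⟩ _ ⟨i', j', k', -, rfl⟩ -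
    refine ⟨isExtreme_triangleTile_inter .., ?_⟩
    rw [inter_comm]
    exact isExtreme_triangleTile_inter ..
  have hpoly : ∀ T ∈ 𝒯, IsConvexPolytope T ∧ (Set.extremePoints ℝ T).ncard = 3 := by
    rintro _ ⟨i, j, k, rfl | rfl, rfl⟩
    exacts [triangleTile_lower i j, triangleTile_upper i j]
  refine ⟨𝒯, ⟨fun T hT => (hpoly T hT).1.isClosed, ?_, hface.pairwise_interior⟩, ?_, hface, hpoly⟩
  · refine eq_univ_of_forall fun x => ?_
    have h₀ := mem_Icc_floor_div_mul one_pos (x 0)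
    have h₁ := mem_Icc_floor_div_mul one_pos (x 1)
    have h₂ := mem_Icc_floor_div_mul one_pos (x 0 + x 1)
    refine ⟨_, ⟨_, _, _, ?_, rfl⟩, h₀, h₁, h₂⟩
    simp only [div_one]
    have := Int.le_floor_add (x 0) (x 1)
    have := Int.le_floor_add_floor (x 0) (x 1)
    omega
  · intro K hK
    obtain ⟨M, hM⟩ := exists_forall_abs_coord_le hK
    refine (((finite_setOf_strip_meets one_pos M).prod ((finite_setOf_strip_meets one_pos M).prod
      (finite_setOf_strip_meets one_pos (M + M)))).image
      fun q : ℤ × ℤ × ℤ => triangleTile q.1 q.2.1 q.2.2).subset ?_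
    rintro _ ⟨⟨i, j, k, -, rfl⟩, x, ⟨hx₀, hx₁, hx₂⟩, hxK⟩
    obtain ⟨hM₀, hM₁⟩ := hM x hxK
    exact ⟨(i, j, k), ⟨⟨_, hx₀, hM₀⟩, ⟨_, hx₁, hM₁⟩, _, hx₂,
      (abs_add_le _ _).trans (add_le_add hM₀ hM₁)⟩, rfl⟩

/-! ### Chords of the parabola -/

/-- The affine function interpolating `x ↦ x ^ 2` at `m h` and `(m + 1) h`. -/
def chord (h : ℝ) (m : ℤ) (x : ℝ) : ℝ := x ^ 2 - (x - m * h) * (x - (m + 1) * h)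

lemma chord_convexCombo (h : ℝ) (m : ℤ) {α β : ℝ} (hαβ : α + β = 1) (x y : ℝ) :
    chord h m (α * x + β * y) = α * chord h m x + β * chord h m y := by
  obtain rfl : β = 1 - α := by linarith
  simp only [chord]
  ring

lemma chord_le_chord {h : ℝ} (hh : 0 < h) {b : ℤ} {x : ℝ} (hx : x ∈ Icc (b * h) ((b + 1) * h))
    (m : ℤ) : chord h m x ≤ chord h b x := by
  obtain ⟨hx₁, hx₂⟩ := hx
  have hb : (x - b * h) * (x - (b + 1) * h) ≤ 0 :=
    mul_nonpos_of_nonneg_of_nonpos (by linarith) (by linarith)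
  unfold chord
  rcases lt_trichotomy m b with hm | rfl | hm
  · have : (m : ℝ) + 1 ≤ b := by exact_mod_cast hm
    have := mul_le_mul_of_nonneg_right this hh.le
    have : 0 ≤ (x - m * h) * (x - (m + 1) * h) := mul_nonneg (by linarith) (by linarith)
    linarith
  · rfl
  · have : (b : ℝ) + 1 ≤ m := by exact_mod_cast hm
    have := mul_le_mul_of_nonneg_right this hh.le
    have : 0 ≤ (x - m * h) * (x - (m + 1) * h) :=
      mul_nonneg_of_nonpos_of_nonpos (by linarith) (by linarith)
    linarith

lemma mem_Icc_of_chord_le_chord {h : ℝ} (hh : 0 < h) {b : ℤ} {x : ℝ}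
    (H : ∀ m, chord h m x ≤ chord h b x) : x ∈ Icc (b * h) ((b + 1) * h) := by
  have h₁ := H (b - 1)
  have h₂ := H (b + 1)
  simp only [chord] at h₁ h₂
  push_cast at h₁ h₂
  constructor
  · have : 0 ≤ h * (x - b * h) := by linarith
    linarith [nonneg_of_mul_nonneg_right this hh]
  · have : 0 ≤ h * ((b + 1) * h - x) := by linarith
    linarith [nonneg_of_mul_nonneg_right this hh]

lemma sq_le_chord {h : ℝ} {b : ℤ} {x : ℝ} (hx : x ∈ Icc (b * h) ((b + 1) * h)) :
    x ^ 2 ≤ chord h b x := by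
  have : (x - b * h) * (x - (b + 1) * h) ≤ 0 :=
    mul_nonpos_of_nonneg_of_nonpos (by linarith [hx.1]) (by linarith [hx.2])
  unfold chord
  linarith

lemma chord_le_sq_add (h : ℝ) (m : ℤ) (x : ℝ) : chord h m x ≤ x ^ 2 + h ^ 2 := by
  unfold chord
  nlinarith [sq_nonneg (2 * (x - m * h) - h), sq_nonneg h]

lemma chord_int_mul_le (h : ℝ) (b m : ℤ) : chord h b (m * h) ≤ (m * h) ^ 2 := by
  have h₁ : (0 : ℤ) ≤ (m - b) * (m - (b + 1)) := by
    rcases le_or_gt m b with hmb | hmb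
    · exact mul_nonneg_of_nonpos_of_nonpos (by omega) (by omega)
    · exact mul_nonneg (by omega) (by omega)
  have h₂ : (0 : ℝ) ≤ (m - b) * (m - (b + 1)) := by exact_mod_cast h₁
  have := mul_nonneg h₂ (sq_nonneg h)
  unfold chord
  linarith

lemma chord_le_chord_of_eq_mul {h h' : ℝ} {K : ℕ} (hh : 0 < h) (hK : h = K * h') {a : ℤ} {x : ℝ}
    (hx : x ∈ Icc (a * h) ((a + 1) * h)) (b : ℤ) : chord h' b x ≤ chord h a x := by
  have h₁ := chord_int_mul_le h' b (a * K)
  have h₂ := chord_int_mul_le h' b ((a + 1) * K)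
  push_cast at h₁ h₂
  rw [mul_assoc, ← hK] at h₁ h₂
  have h₃ := mul_nonneg (sub_nonneg.mpr hx.2) (sub_nonneg.mpr h₁)
  have h₄ := mul_nonneg (sub_nonneg.mpr hx.1) (sub_nonneg.mpr h₂)
  have : 0 ≤ h * (chord h a x - chord h' b x) := by
    unfold chord at *
    linarith
  linarith [nonneg_of_mul_nonneg_right this hh]

/-- The mesh `k ^ (-n)` of the `n`-th interpolation of the parabola. -/
def mesh (k : ℕ) (n : ℤ) : ℝ := (k : ℝ) ^ (-n)

lemma mesh_pos {k : ℕ} (hk : 1 ≤ k) (n : ℤ) : 0 < mesh k n :=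
  zpow_pos (by exact_mod_cast hk) _

lemma mesh_le_one {k : ℕ} (hk : 1 ≤ k) {n : ℤ} (hn : 0 ≤ n) : mesh k n ≤ 1 :=
  zpow_le_one_of_nonpos₀ (by exact_mod_cast hk) (by omega)

lemma mesh_eq_mul {k : ℕ} (hk : 1 ≤ k) (n : ℤ) (l : ℕ) :
    mesh k n = (k ^ l : ℕ) * mesh k (n + l) := by
  have : (k : ℝ) ≠ 0 := by positivity
  rw [mesh, mesh, Nat.cast_pow, ← zpow_natCast, ← zpow_add₀ this]
  congr 1
  ring

lemma mesh_eq_mul_succ {k : ℕ} (hk : 1 ≤ k) (n : ℤ) : mesh k n = k * mesh k (n + 1) := by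
  simpa using mesh_eq_mul hk n 1

/-- The region over `[a h, (a + 1) h]`, for `h = k ^ (-n)`, below the chord of the parabola
`y = x ^ 2 - n` and above the `k` chords of the parabola `y = x ^ 2 - (n + 1)` of mesh `h / k`. -/
def chordTile (k : ℕ) (n a : ℤ) : Set (Euc 2) :=
  {p | p 0 ∈ Icc (a * mesh k n) ((a + 1) * mesh k n) ∧
    (∀ b, chord (mesh k (n + 1)) b (p 0) - (n + 1) ≤ p 1) ∧ p 1 ≤ chord (mesh k n) a (p 0) - n}

lemma sq_sub_le_of_mem_chordTile {k : ℕ} (hk : 1 ≤ k) {n a : ℤ} {p : Euc 2}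
    (hp : p ∈ chordTile k n a) : p 0 ^ 2 - (n + 1) ≤ p 1 := by
  have := sq_le_chord (mem_Icc_floor_div_mul (mesh_pos hk (n + 1)) (p 0))
  linarith [hp.2.1 ⌊p 0 / mesh k (n + 1)⌋]

lemma disjoint_chordTile_of_add_two_le {k : ℕ} (hk : 1 ≤ k) {n m a b : ℤ} (h : n + 2 ≤ m)
    {p : Euc 2} (hp : p ∈ chordTile k n a) (hp' : p ∈ chordTile k m b) : False := by
  obtain ⟨l, rfl⟩ := Int.le.dest h
  have hx := mem_Icc_floor_div_mul (mesh_pos hk (n + 1)) (p 0)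
  have hmesh := mesh_eq_mul hk (n + 1) (l + 1)
  rw [show n + 1 + ((l + 1 : ℕ) : ℤ) = n + 2 + l by push_cast; ring] at hmesh
  have h₁ := chord_le_chord_of_eq_mul (mesh_pos hk (n + 1)) hmesh hx b
  have h₂ := hp.2.1 ⌊p 0 / mesh k (n + 1)⌋
  have h₃ := hp'.2.2
  push_cast at h₃
  have : (0 : ℝ) ≤ l := Nat.cast_nonneg l
  linarith

lemma isExtreme_chordTile_inter {k : ℕ} (hk : 1 ≤ k) (n a m b : ℤ) :
    IsExtreme ℝ (chordTile k n a) (chordTile k n a ∩ chordTile k m b) := by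
  refine isExtreme_inter_of_forall_mem ?_
  intro u hu v hv α β hα hβ hαβ hwS hwT
  rcases le_or_gt (n + 2) m with hnm | hnm
  · exact (disjoint_chordTile_of_add_two_le hk hnm hwS hwT).elim
  rcases le_or_gt (m + 2) n with hmn | hmn
  · exact (disjoint_chordTile_of_add_two_le hk hmn hwT hwS).elim
  have hw := hwT
  simp only [chordTile, mem_ofPred_eq, PiLp.add_apply, PiLp.smul_apply, smul_eq_mul,
    chord_convexCombo _ _ hαβ] at hw hwS
  obtain rfl | rfl | rfl : m = n ∨ m = n + 1 ∨ n = m + 1 := by omega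
  · have cast_succ (c : ℤ) : ((c + 1 : ℤ) : ℝ) = c + 1 := by push_cast; ring
    have hu₀ : u 0 ∈ Icc (b * mesh k m) ((b + 1) * mesh k m) := by
      rw [← cast_succ] at hw ⊢
      exact left_mem_of_convexCombo_mem (mesh_pos hk m) hα hβ hαβ hu.1 hv.1 hw.1
    exact ⟨hu₀, hu.2.1,
      hu.2.2.trans (sub_le_sub_right (chord_le_chord (mesh_pos hk m) hu₀ a) _)⟩
  · have hn : (n + 1 : ℝ) = α * (n + 1) + β * (n + 1) := by rw [← add_mul, hαβ, one_mul]
    have hu₁ : u 1 = chord (mesh k (n + 1)) b (u 0) - (n + 1) := by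
      have := left_eq_of_convexCombo_le (c := 0) hα hβ hαβ
        (sub_nonneg.mpr (hu.2.1 b)) (sub_nonneg.mpr (hv.2.1 b))
        (by have h' := hw.2.2; push_cast at h'; linarith)
      linarith
    have hu₀ : u 0 ∈ Icc (b * mesh k (n + 1)) ((b + 1) * mesh k (n + 1)) := by
      refine mem_Icc_of_chord_le_chord (mesh_pos hk _) fun c => ?_
      linarith [hu.2.1 c]
    refine ⟨hu₀, fun c => ?_, ?_⟩
    · have := chord_le_chord_of_eq_mul (mesh_pos hk _) (mesh_eq_mul_succ hk (n + 1)) hu₀ c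
      push_cast
      linarith
    · push_cast
      exact hu₁.le
  · have hm : (m + 1 : ℝ) = α * (m + 1) + β * (m + 1) := by rw [← add_mul, hαβ, one_mul]
    have hu₁ : u 1 = chord (mesh k (m + 1)) a (u 0) - (m + 1) := by
      have hu' := hu.2.2
      have hv' := hv.2.2
      push_cast at hu' hv'
      have := left_eq_of_le_convexCombo (c := 0) hα hβ hαβ
        (sub_nonpos.mpr hu') (sub_nonpos.mpr hv') (by linarith [hw.2.1 a])
      linarith
    have hu₀ : u 0 ∈ Icc (b * mesh k m) ((b + 1) * mesh k m) := by
      have hw₀ := hw.1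
      have e₁ : (b : ℝ) * mesh k m = ((b * k : ℤ) : ℝ) * mesh k (m + 1) := by
        rw [mesh_eq_mul_succ hk m]; push_cast; ring
      have e₂ : ((b : ℝ) + 1) * mesh k m = (((b + 1) * k : ℤ) : ℝ) * mesh k (m + 1) := by
        rw [mesh_eq_mul_succ hk m]; push_cast; ring
      rw [e₁, e₂] at hw₀ ⊢
      exact left_mem_of_convexCombo_mem (mesh_pos hk _) hα hβ hαβ hu.1 hv.1 hw₀
    refine ⟨hu₀, fun c => ?_, ?_⟩
    · rw [hu₁]
      exact sub_le_sub_right (chord_le_chord (mesh_pos hk _) hu.1 c) _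
    · have := chord_le_chord_of_eq_mul (mesh_pos hk _) (mesh_eq_mul_succ hk m) hu₀ a
      linarith

lemma convex_chordTile (k : ℕ) (n a : ℤ) : Convex ℝ (chordTile k n a) := by
  rintro u ⟨hu₀, hu₁, hu₂⟩ v ⟨hv₀, hv₁, hv₂⟩ α β hα hβ hαβ
  simp only [chordTile, mem_ofPred_eq, PiLp.add_apply, PiLp.smul_apply, smul_eq_mul,
    chord_convexCombo _ _ hαβ]
  refine ⟨convex_Icc _ _ hu₀ hv₀ hα hβ hαβ, fun b => ?_, ?_⟩
  · have h₁ := mul_le_mul_of_nonneg_left (hu₁ b) hα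
    have h₂ := mul_le_mul_of_nonneg_left (hv₁ b) hβ
    have h₃ : (n + 1 : ℝ) = α * (n + 1) + β * (n + 1) := by rw [← add_mul, hαβ, one_mul]
    linarith
  · have h₁ := mul_le_mul_of_nonneg_left hu₂ hα
    have h₂ := mul_le_mul_of_nonneg_left hv₂ hβ
    have h₃ : (n : ℝ) = α * n + β * n := by rw [← add_mul, hαβ, one_mul]
    linarith

lemma exists_mem_chordTile {k : ℕ} (hk : 1 ≤ k) (p : Euc 2) : ∃ n a, p ∈ chordTile k n a := by
  obtain ⟨n, ⟨a, ha, hn⟩, hmax⟩ := Int.exists_greatest_of_bdd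
    (P := fun n => ∃ a : ℤ, p 0 ∈ Icc (a * mesh k n) ((a + 1) * mesh k n) ∧
      p 1 ≤ chord (mesh k n) a (p 0) - n)
    (by
      refine ⟨max 0 ⌈p 0 ^ 2 + 1 - p 1⌉, ?_⟩
      rintro n ⟨a, -, hn⟩
      rcases le_or_gt n 0 with h | h
      · exact h.trans (le_max_left _ _)
      · refine le_trans ?_ (le_max_right _ _)
        have h₁ := chord_le_sq_add (mesh k n) a (p 0)
        have h₂ : mesh k n ^ 2 ≤ 1 := pow_le_one₀ (mesh_pos hk n).le (mesh_le_one hk h.le)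
        have h₃ : (n : ℝ) ≤ p 0 ^ 2 + 1 - p 1 := by linarith
        exact Int.cast_le.mp (h₃.trans (Int.le_ceil _)))
    (by
      have hx := mem_Icc_floor_div_mul (mesh_pos hk ⌊-p 1⌋) (p 0)
      refine ⟨⌊-p 1⌋, _, hx, ?_⟩
      linarith [sq_le_chord hx, Int.floor_le (-p 1), sq_nonneg (p 0)])
  refine ⟨n, a, ha, fun b => ?_, hn⟩
  have hx := mem_Icc_floor_div_mul (mesh_pos hk (n + 1)) (p 0)
  by_contra! hlt
  have := hmax (n + 1) ⟨_, hx, by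
    have := chord_le_chord (mesh_pos hk (n + 1)) hx b
    push_cast
    linarith⟩
  omega

lemma finite_setOf_chordTile_meets {k : ℕ} (hk : 1 ≤ k) {K : Set (Euc 2)} (hK : IsCompact K) :
    {q : ℤ × ℤ | (chordTile k q.1 q.2 ∩ K).Nonempty}.Finite := by
  obtain ⟨M, hM⟩ := exists_forall_abs_coord_le hK
  refine ((Set.finite_Icc ⌊-M - 1⌋ (max 0 ⌈M ^ 2 + 1 + M⌉)).biUnion fun n _ =>
    (finite_setOf_strip_meets (mesh_pos hk n) M).image (Prod.mk n)).subset ?_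
  rintro ⟨n, a⟩ ⟨p, hp, hpK⟩
  obtain ⟨hM₀, hM₁⟩ := hM p hpK
  have hM₁' := abs_le.mp hM₁
  refine mem_biUnion (x := n) ⟨?_, ?_⟩ ⟨a, ⟨_, hp.1, hM₀⟩, rfl⟩
  · have h₁ := sq_sub_le_of_mem_chordTile hk hp
    have h₂ : -M - 1 ≤ n := by linarith [sq_nonneg (p 0)]
    exact_mod_cast (Int.floor_le _).trans h₂
  · rcases le_or_gt n 0 with h | h
    · exact h.trans (le_max_left _ _)
    · refine le_trans ?_ (le_max_right _ _)
      have h₁ := chord_le_sq_add (mesh k n) a (p 0)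
      have h₂ : mesh k n ^ 2 ≤ 1 := pow_le_one₀ (mesh_pos hk n).le (mesh_le_one hk h.le)
      have h₃ : p 0 ^ 2 ≤ M ^ 2 := sq_le_sq' (abs_le.mp hM₀).1 (abs_le.mp hM₀).2
      have h₄ : (n : ℝ) ≤ M ^ 2 + 1 + M := by linarith [hp.2.2]
      exact_mod_cast h₄.trans (Int.le_ceil _)

lemma mk_chord_mem_of_convex {C : Set (Euc 2)} (hC : Convex ℝ C) {h : ℝ} (hh : 0 < h) {b : ℤ}
    {d s : ℝ} (h₁ : !₂[b * h, (b * h) ^ 2 - d] ∈ C)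
    (h₂ : !₂[(b + 1) * h, ((b + 1) * h) ^ 2 - d] ∈ C)
    (hs : s ∈ Icc (b * h) ((b + 1) * h)) : !₂[s, chord h b s - d] ∈ C := by
  have := hC h₁ h₂ (a := ((b + 1) * h - s) / h) (b := (s - b * h) / h)
    (div_nonneg (by linarith [hs.2]) hh.le) (div_nonneg (by linarith [hs.1]) hh.le)
    (by field_simp; ring)
  convert this using 1
  apply euc_two_ext <;> simp [chord] <;> field_simp <;> ring

lemma mk_mem_of_convex_of_between {C : Set (Euc 2)} (hC : Convex ℝ C) {s y₁ y₂ : ℝ}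
    (h₁ : !₂[s, y₁] ∈ C) (h₂ : !₂[s, y₂] ∈ C) {y : ℝ} (hy₁ : y₁ ≤ y) (hy₂ : y ≤ y₂) :
    !₂[s, y] ∈ C := by
  rcases (hy₁.trans hy₂).eq_or_lt with h | h
  · rwa [show y = y₁ by linarith]
  have h' : 0 < y₂ - y₁ := by linarith
  have := hC h₁ h₂ (a := (y₂ - y) / (y₂ - y₁)) (b := (y - y₁) / (y₂ - y₁))
    (div_nonneg (by linarith) h'.le) (div_nonneg (by linarith) h'.le) (by field_simp; ring)
  convert this using 1
  apply euc_two_ext <;> simp <;> field_simp <;> ring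

lemma exists_mem_Icc_between {h s : ℝ} (hh : 0 < h) {A : ℤ} {k : ℕ} (hk : 1 ≤ k)
    (hs : s ∈ Icc (A * h) ((A + k) * h)) :
    ∃ b : ℤ, A ≤ b ∧ b + 1 ≤ A + k ∧ s ∈ Icc (b * h) ((b + 1) * h) := by
  rcases hs.2.eq_or_lt with h' | h'
  · refine ⟨A + k - 1, by omega, by omega, ?_⟩
    push_cast
    constructor <;> nlinarith
  · refine ⟨⌊s / h⌋, Int.le_floor.mpr ((le_div_iff₀ hh).mpr hs.1), ?_, mem_Icc_floor_div_mul hh s⟩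
    refine Int.floor_lt.mpr ?_
    push_cast
    exact (div_lt_iff₀ hh).mpr h'

lemma eq_and_eq_of_convexCombo_on_parabola {α β x₁ x₂ y₁ y₂ x d : ℝ} (hα : 0 < α) (hβ : 0 < β)
    (hαβ : α + β = 1) (h₁ : x₁ ^ 2 - d ≤ y₁) (h₂ : x₂ ^ 2 - d ≤ y₂) (hx : α * x₁ + β * x₂ = x)
    (hy : α * y₁ + β * y₂ = x ^ 2 - d) : x₁ = x ∧ y₁ = x ^ 2 - d := by
  obtain rfl : β = 1 - α := by linarith
  have h₃ := mul_le_mul_of_nonneg_left h₁ hα.le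
  have h₄ := mul_le_mul_of_nonneg_left h₂ hβ.le
  have h₅ : α * (1 - α) * (x₁ - x₂) ^ 2 ≤ 0 := by
    subst hx
    linarith
  have h₆ : (x₁ - x₂) ^ 2 = 0 :=
    le_antisymm (nonpos_of_mul_nonpos_right h₅ (mul_pos hα hβ)) (sq_nonneg _)
  have h₇ : x₁ = x₂ := by linarith [pow_eq_zero_iff two_ne_zero |>.mp h₆]
  subst h₇
  have h₈ : x₁ = x := by linarith
  subst h₈
  exact ⟨rfl, left_eq_of_convexCombo_le hα hβ hαβ h₁ h₂ hy.le⟩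

lemma mk_mem_chordTile {k : ℕ} (hk : 1 ≤ k) {n a : ℤ} {x y : ℝ}
    (hx : x ∈ Icc (a * mesh k n) ((a + 1) * mesh k n))
    (h₁ : chord (mesh k n) a x - (n + 1) ≤ y) (h₂ : y ≤ chord (mesh k n) a x - n) :
    !₂[x, y] ∈ chordTile k n a :=
  ⟨hx, fun b => (sub_le_sub_right (chord_le_chord_of_eq_mul (mesh_pos hk n)
    (mesh_eq_mul_succ hk n) hx b) _).trans h₁, h₂⟩

lemma chordTile_isConvexPolytope {k : ℕ} (hk : 1 ≤ k) (n a : ℤ) :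
    IsConvexPolytope (chordTile k n a) ∧
      (Set.extremePoints ℝ (chordTile k n a)).ncard = k + 3 := by
  classical
  have hh := mesh_pos hk n
  have hh' := mesh_pos hk (n + 1)
  have hmul := mesh_eq_mul_succ hk n
  set h := mesh k n with hh_def
  set h' := mesh k (n + 1) with hh'_def
  set P : ℤ → Euc 2 := fun m => !₂[m * h', (m * h') ^ 2 - (n + 1)] with hP
  set u : Euc 2 := !₂[a * h, (a * h) ^ 2 - n] with hu
  set v : Euc 2 := !₂[(a + 1) * h, ((a + 1) * h) ^ 2 - n] with hv
  set V : Finset (Euc 2) := insert u (insert v ((Finset.Icc (a * k) (a * k + k)).image P)) with hV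
  have hah : ((a * k : ℤ) : ℝ) * h' = a * h := by rw [hmul]; push_cast; ring
  have hah' : (((a * k : ℤ) : ℝ) + k) * h' = (a + 1) * h := by rw [hmul]; push_cast; ring
  have hleft : a * h ∈ Icc (a * h) ((a + 1) * h) := ⟨le_rfl, by linarith⟩
  have hright : (a + 1) * h ∈ Icc (a * h) ((a + 1) * h) := ⟨by linarith, le_rfl⟩
  have hcl : chord h a (a * h) = (a * h) ^ 2 := by simp [chord]
  have hcr : chord h a ((a + 1) * h) = ((a + 1) * h) ^ 2 := by simp [chord]
  have hsub : chordTile k n a ⊆ convexHull ℝ (V : Set (Euc 2)) := by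
    rintro x ⟨hx₀, hx₁, hx₂⟩
    have hconv := convex_convexHull ℝ (V : Set (Euc 2))
    have hmemV {w : Euc 2} (hw : w ∈ V) : w ∈ convexHull ℝ (V : Set (Euc 2)) :=
      subset_convexHull ℝ _ hw
    have hPV {m : ℤ} (h₁ : a * k ≤ m) (h₂ : m ≤ a * k + k) : P m ∈ V :=
      Finset.mem_insert_of_mem (Finset.mem_insert_of_mem
        (Finset.mem_image_of_mem P (Finset.mem_Icc.mpr ⟨h₁, h₂⟩)))
    obtain ⟨b, hb₁, hb₂, hb⟩ := exists_mem_Icc_between (s := x 0) (A := a * k) hh' hk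
      (by rw [hah, hah']; exact hx₀)
    have hlow := mk_chord_mem_of_convex (d := n + 1) hconv hh' (hmemV (hPV hb₁ (by omega)))
      (by simpa [hP] using hmemV (hPV (hb₁.trans (by omega)) hb₂)) hb
    have hhigh := mk_chord_mem_of_convex (d := n) hconv hh
      (hmemV (w := u) (by simp [hV])) (hmemV (w := v) (by simp [hV])) hx₀
    have := mk_mem_of_convex_of_between hconv hlow hhigh (hx₁ b) hx₂
    convert this using 1
    apply euc_two_ext <;> simp
  have htop (x : ℝ) (hx : x ∈ Icc (a * h) ((a + 1) * h)) (hc : chord h a x = x ^ 2)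
      (H : ∀ s t α β : ℝ, 0 < α → 0 < β → α + β = 1 → s ∈ Icc (a * h) ((a + 1) * h) →
        t ∈ Icc (a * h) ((a + 1) * h) → α * s + β * t = x → s = x) :
      !₂[x, x ^ 2 - n] ∈ Set.extremePoints ℝ (chordTile k n a) := by
    rw [← hc]
    refine mem_extremePoints_of_forall_eq
      (mk_mem_chordTile hk hx (sub_le_sub_left (by linarith) _) le_rfl) ?_
    rintro p ⟨hp₀, -, hp₁⟩ q ⟨hq₀, -, hq₁⟩ α β hα hβ hαβ hw
    have h₀ : α * p 0 + β * q 0 = x := congrArg (· 0) hw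
    have h₁ : α * p 1 + β * q 1 = chord h a x - n := congrArg (· 1) hw
    have hpx := H _ _ α β hα hβ hαβ hp₀ hq₀ h₀
    have hqx := H _ _ β α hβ hα (by linarith) hq₀ hp₀ (by linarith)
    rw [hpx] at hp₁
    rw [hqx] at hq₁
    exact euc_two_ext hpx (left_eq_of_le_convexCombo hα hβ hαβ hp₁ hq₁ h₁.ge)
  have hext : ∀ w ∈ V, w ∈ Set.extremePoints ℝ (chordTile k n a) := by
    intro w hw
    simp only [hV, Finset.mem_insert, Finset.mem_image, Finset.mem_Icc] at hw
    rcases hw with rfl | rfl | ⟨m, ⟨hm₁, hm₂⟩, rfl⟩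
    · exact htop _ hleft hcl fun s t α β hα hβ hαβ hs ht h₀ =>
        left_eq_of_convexCombo_le hα hβ hαβ hs.1 ht.1 h₀.le
    · exact htop _ hright hcr fun s t α β hα hβ hαβ hs ht h₀ =>
        left_eq_of_le_convexCombo hα hβ hαβ hs.2 ht.2 h₀.ge
    · have hm : (m * h' : ℝ) ∈ Icc (a * h) ((a + 1) * h) := by
        rw [← hah, ← hah']
        have h₁ : ((a * k : ℤ) : ℝ) ≤ m := by exact_mod_cast hm₁
        have h₂ : (m : ℝ) ≤ ((a * k : ℤ) : ℝ) + k := by exact_mod_cast hm₂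
        exact ⟨mul_le_mul_of_nonneg_right h₁ hh'.le, mul_le_mul_of_nonneg_right h₂ hh'.le⟩
      have hsq := sq_le_chord hm
      refine mem_extremePoints_of_forall_eq
        ⟨hm, fun b => sub_le_sub_right (chord_int_mul_le h' b m) _, ?_⟩ ?_
      · change (m * h') ^ 2 - (n + 1 : ℝ) ≤ chord h a (m * h') - n
        linarith
      · intro p hp q hq α β hα hβ hαβ hw
        obtain ⟨h₀, h₁⟩ := eq_and_eq_of_convexCombo_on_parabola hα hβ hαβ
          (sq_sub_le_of_mem_chordTile hk hp) (sq_sub_le_of_mem_chordTile hk hq)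
          (congrArg (· 0) hw) (congrArg (· 1) hw)
        exact euc_two_ext h₀ h₁
  obtain ⟨hhull, hextr⟩ := eq_convexHull_and_extremePoints_eq (convex_chordTile k n a) hsub hext
  refine ⟨⟨⟨_, hhull⟩, ?_⟩, ?_⟩
  · have h₀ : Continuous fun p : Euc 2 => p 0 := by fun_prop
    have h₁ : Continuous fun p : Euc 2 => p 1 := by fun_prop
    have h₂ : Continuous fun p : Euc 2 => chord h a (p 0) := by unfold chord; fun_prop
    refine ⟨!₂[a * h + h / 2, chord h a (a * h + h / 2) - (n + 1 / 2)], interior_maximal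
      (t := {p : Euc 2 | a * h < p 0} ∩ {p | p 0 < (a + 1) * h} ∩
        {p | chord h a (p 0) - (n + 1) < p 1} ∩ {p | p 1 < chord h a (p 0) - n}) ?_
      ((((isOpen_lt continuous_const h₀).inter (isOpen_lt h₀ continuous_const)).inter
        (isOpen_lt (h₂.sub continuous_const) h₁)).inter
        (isOpen_lt h₁ (h₂.sub continuous_const))) ?_⟩
    · rintro p ⟨⟨⟨h₁, h₂⟩, h₃⟩, h₄⟩
      have := mk_mem_chordTile hk ⟨h₁.le, h₂.le⟩ h₃.le h₄.le
      convert this using 1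
      apply euc_two_ext <;> simp
    · refine ⟨⟨⟨?_, ?_⟩, ?_⟩, ?_⟩ <;> norm_num <;> linarith
  · have hinj : Function.Injective P := fun m m' hmm => by
      simpa [hP, hh'.ne'] using congrArg (· 0) hmm
    have hsqP (m : ℤ) : P m 1 = P m 0 ^ 2 - (n + 1) := by simp [hP]
    have hne {w : Euc 2} (hw : w 1 = w 0 ^ 2 - n) :
        w ∉ (Finset.Icc (a * k) (a * k + k)).image P := by
      simp only [Finset.mem_image, not_exists, not_and]
      rintro m - rfl
      linarith [hsqP m]
    have huv : u ≠ v := fun huv => by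
      have : (a : ℝ) * h = (a + 1) * h := by simpa [hu, hv] using congrArg (· 0) huv
      linarith
    rw [hextr, Set.ncard_coe_finset, hV, Finset.card_insert_of_notMem, Finset.card_insert_of_notMem,
      Finset.card_image_of_injective _ hinj, Int.card_Icc]
    · omega
    · exact hne (by simp [hv])
    · rw [Finset.mem_insert, not_or]
      exact ⟨huv, hne (by simp [hu])⟩

/-- The plane admits a face-to-face tiling by `(k + 3)`-gons for every `k ≥ 1`. -/
lemma exists_chordTile_tiling {k : ℕ} (hk : 1 ≤ k) :
    ∃ 𝒯 : Set (Set (Euc 2)), IsTiling 𝒯 ∧ LocallyFiniteTiling 𝒯 ∧ FaceToFace 𝒯 ∧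
      ∀ T ∈ 𝒯, IsConvexPolytope T ∧ (Set.extremePoints ℝ T).ncard = k + 3 := by
  set 𝒯 : Set (Set (Euc 2)) := range fun q : ℤ × ℤ => chordTile k q.1 q.2 with h𝒯
  have hface : FaceToFace 𝒯 := by
    rintro _ ⟨q, rfl⟩ _ ⟨q', rfl⟩ -
    refine ⟨isExtreme_chordTile_inter hk .., ?_⟩
    rw [inter_comm]
    exact isExtreme_chordTile_inter hk ..
  have hpoly : ∀ T ∈ 𝒯, IsConvexPolytope T ∧ (Set.extremePoints ℝ T).ncard = k + 3 := by
    rintro _ ⟨q, rfl⟩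
    exact chordTile_isConvexPolytope hk q.1 q.2
  refine ⟨𝒯, ⟨fun T hT => (hpoly T hT).1.isClosed, ?_, hface.pairwise_interior⟩, ?_, hface, hpoly⟩
  · refine eq_univ_of_forall fun x => ?_
    obtain ⟨n, a, hx⟩ := exists_mem_chordTile hk x
    exact ⟨_, ⟨(n, a), rfl⟩, hx⟩
  · intro K hK
    refine ((finite_setOf_chordTile_meets hk hK).image
      fun q : ℤ × ℤ => chordTile k q.1 q.2).subset ?_
    rintro _ ⟨⟨q, rfl⟩, hq⟩
    exact ⟨q, hq, rfl⟩

/-- for every `p ≥ 3` the plane admits a monotypic face-to-face tiling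
by convex `p`-gons. -/
theorem monotypic_tiling_by_p_gons (p : ℕ) (hp : 3 ≤ p) :
    ∃ 𝒯 : Set (Set (Euc 2)), IsTiling 𝒯 ∧ LocallyFiniteTiling 𝒯 ∧ FaceToFace 𝒯 ∧
      ∀ T ∈ 𝒯, IsConvexPolytope T ∧ (Set.extremePoints ℝ T).ncard = p := by
  obtain ⟨k, rfl⟩ := Nat.exists_eq_add_of_le' hp
  rcases k.eq_zero_or_pos with rfl | hk
  · exact exists_triangle_tiling
  · exact exists_chordTile_tiling hk
end
end
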